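/- arXiv:1308.3994 — 2 statements merged into one kernel-verified Lean document; each statement's English description precedes it below -/
import Mathlib

section
/- Let d ≥ 1, let V be a locally bounded Borel measurable real-valued function on the d×d real symmetric matrices, and define f : ℝ^{d×d} → ℝ by f(F) := V(sym F). Define the quasiconvexification f^{qc}(F) := sup { g(F) : g : ℝ^{d×d} → ℝ quasiconvex, g ≤ f } and the quasiconvexification on linear strains V^{qce}(E) := sup { h(E) : h real-valued on symmetric matrices, quasiconvex on linear strains, h ≤ V }, both suprema taken in ℝ ∪ {−∞} with the convention that the supremum over the empty set is −∞. Then f^{qc}(F) = V^{qce}(sym F) for every F ∈ ℝ^{d×d}. Here g is quasiconvex means: for every bounded open set U ⊂ ℝ^d, every F ∈ ℝ^{d×d}, and every Lipschitz map φ : ℝ^d → ℝ^d with compact support contained in U, g(F)·|U| ≤ ∫_U g(F + Dφ(x)) dx; and h is quasiconvex on linear strains means: for every bounded open set U ⊂ ℝ^d, every symmetric E, and every such φ, h(E)·|U| ≤ ∫_U h(E + e(φ)(x)) dx, where e(φ) := sym(Dφ). -/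
open Matrix MeasureTheory

noncomputable section

/-- Real `d × d` matrices. -/
abbrev Mat (d : ℕ) := Matrix (Fin d) (Fin d) ℝ

instance (d : ℕ) : MeasurableSpace (Mat d) := borel _
instance (d : ℕ) : BorelSpace (Mat d) := ⟨rfl⟩

/-- Real symmetric `d × d` matrices. -/
abbrev SymMat (d : ℕ) := {A : Mat d // A.IsSymm}

/-- Frobenius norm of a real `d × d` matrix. -/
def frob {d : ℕ} (F : Mat d) : ℝ := Real.sqrt (∑ i, ∑ j, (F i j) ^ 2)

/-- The symmetric part `sym F = (F + Fᵀ)/2`. -/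
def symPart {d : ℕ} (F : Mat d) : Mat d := (1 / 2 : ℝ) • (F + Fᵀ)

theorem symPart_isSymm {d : ℕ} (F : Mat d) : (symPart F).IsSymm := by
  unfold Matrix.IsSymm symPart
  rw [Matrix.transpose_smul, Matrix.transpose_add, Matrix.transpose_transpose, add_comm]

/-- The symmetric part, as an element of the symmetric matrices. -/
def symPt {d : ℕ} (F : Mat d) : SymMat d := ⟨symPart F, symPart_isSymm F⟩

/-- The (a.e. defined, by Rademacher's theorem) derivative of a Lipschitz map
`φ : ℝ^d → ℝ^d`, as a matrix: `(Dφ)_{ij} = ∂φ_i/∂x_j`. -/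
def Dmat {d : ℕ} (φ : (Fin d → ℝ) → (Fin d → ℝ)) (x : Fin d → ℝ) : Mat d :=
  Matrix.of fun i j => fderiv ℝ φ x (Pi.single j 1) i

/-- `f : ℝ^{d×d} → ℝ` is quasiconvex: for every bounded open `U ⊆ ℝ^d`, every `F`, and
every Lipschitz `φ : ℝ^d → ℝ^d` with compact support contained in `U`,
`f(F)·|U| ≤ ∫_U f(F + Dφ(x)) dx`. -/
def IsQuasiconvex {d : ℕ} (f : Mat d → ℝ) : Prop :=
  ∀ U : Set (Fin d → ℝ), IsOpen U → Bornology.IsBounded U →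
    ∀ F : Mat d, ∀ φ : (Fin d → ℝ) → (Fin d → ℝ),
      (∃ L : NNReal, LipschitzWith L φ) → HasCompactSupport φ → tsupport φ ⊆ U →
      f F * (volume U).toReal ≤ ∫ x in U, f (F + Dmat φ x)

/-- `h`, defined on symmetric matrices, is quasiconvex on linear strains: for every bounded
open `U ⊆ ℝ^d`, every symmetric `E`, and every Lipschitz `φ : ℝ^d → ℝ^d` with compact
support contained in `U`, `h(E)·|U| ≤ ∫_U h(E + e(φ)(x)) dx`, where `e(φ) = sym(Dφ)`. -/
def IsQuasiconvexOnLinearStrains {d : ℕ} (h : SymMat d → ℝ) : Prop :=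
  ∀ U : Set (Fin d → ℝ), IsOpen U → Bornology.IsBounded U →
    ∀ E : SymMat d, ∀ φ : (Fin d → ℝ) → (Fin d → ℝ),
      (∃ L : NNReal, LipschitzWith L φ) → HasCompactSupport φ → tsupport φ ⊆ U →
      h E * (volume U).toReal ≤
        ∫ x in U, h ⟨E.1 + symPart (Dmat φ x), E.2.add (symPart_isSymm _)⟩

/-- The quasiconvexification `f^{qc}(F) = sup { g(F) : g quasiconvex, g ≤ f }`, computed in
`ℝ ∪ {−∞}` (inside `EReal`, the supremum of the empty set being `⊥ = −∞`). -/
def qcEnvelope {d : ℕ} (f : Mat d → ℝ) (F : Mat d) : EReal :=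
  sSup {y : EReal | ∃ g : Mat d → ℝ,
    IsQuasiconvex g ∧ (∀ F' : Mat d, g F' ≤ f F') ∧ y = (g F : EReal)}

/-- The quasiconvexification on linear strains
`V^{qce}(E) = sup { h(E) : h quasiconvex on linear strains, h ≤ V }`, computed in
`ℝ ∪ {−∞}` (inside `EReal`). -/
def qceEnvelope {d : ℕ} (V : SymMat d → ℝ) (E : SymMat d) : EReal :=
  sSup {y : EReal | ∃ h : SymMat d → ℝ,
    IsQuasiconvexOnLinearStrains h ∧ (∀ E' : SymMat d, h E' ≤ V E') ∧ y = (h E : EReal)}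

/-- A `1`-Lipschitz scalar function whose gradient takes finitely many values almost
everywhere. -/
def HasFiniteGradients {d : ℕ} (ψ : (Fin d → ℝ) → ℝ) : Prop :=
  LipschitzWith 1 ψ ∧ ∃ S : Set ((Fin d → ℝ) →L[ℝ] ℝ), S.Finite ∧
    ∀ᵐ x, fderiv ℝ ψ x ∈ S

namespace HasFiniteGradients

variable {d : ℕ} {ψ χ : (Fin d → ℝ) → ℝ}

theorem const (c : ℝ) : HasFiniteGradients (fun _ : Fin d → ℝ => c) :=
  ⟨LipschitzWith.const' c, {0}, Set.finite_singleton _, by simp⟩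

theorem clm (L : (Fin d → ℝ) →L[ℝ] ℝ) (hL : LipschitzWith 1 L) :
    HasFiniteGradients (fun x => L x) :=
  ⟨hL, {L}, Set.finite_singleton _, by simp⟩

theorem const_sub (hψ : HasFiniteGradients ψ) (c : ℝ) :
    HasFiniteGradients (fun x => c - ψ x) := by
  obtain ⟨hL, S, hS, hae⟩ := hψ
  refine ⟨?_, (fun L => -L) '' S, hS.image _, ?_⟩
  · refine LipschitzWith.of_dist_le_mul fun x y => ?_
    rw [dist_sub_left]
    exact hL.dist_le_mul x y
  · filter_upwards [hae] with x hx
    exact ⟨_, hx, by rw [fderiv_const_sub]⟩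

theorem neg (hψ : HasFiniteGradients ψ) : HasFiniteGradients (fun x => -ψ x) := by
  simpa using hψ.const_sub 0

theorem max (hψ : HasFiniteGradients ψ) (hχ : HasFiniteGradients χ) :
    HasFiniteGradients (fun x => max (ψ x) (χ x)) := by
  obtain ⟨hL, S, hS, hae⟩ := hψ
  obtain ⟨hL', S', hS', hae'⟩ := hχ
  have hM : LipschitzWith 1 (fun x => Max.max (ψ x) (χ x)) := by
    simpa using hL.max hL'
  refine ⟨hM, S ∪ S', hS.union hS', ?_⟩
  filter_upwards [hae, hae', hL.ae_differentiableAt, hM.ae_differentiableAt]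
    with x hx hx' hd hdM
  rcases lt_trichotomy (ψ x) (χ x) with h | h | h
  · right
    have : (fun x => Max.max (ψ x) (χ x)) =ᶠ[nhds x] χ := by
      filter_upwards [hL.continuous.continuousAt.eventually_lt hL'.continuous.continuousAt h]
        with y hy using max_eq_right hy.le
    rwa [this.fderiv_eq]
  · left
    have hmin : IsLocalMin (fun y => Max.max (ψ y) (χ y) - ψ y) x := by
      refine Filter.Eventually.of_forall fun y => ?_
      simp [h]
    have h0 := hmin.fderiv_eq_zero
    rw [fderiv_fun_sub hdM hd, sub_eq_zero] at h0
    rwa [h0]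
  · left
    have : (fun x => Max.max (ψ x) (χ x)) =ᶠ[nhds x] ψ := by
      filter_upwards [hL'.continuous.continuousAt.eventually_lt hL.continuous.continuousAt h]
        with y hy using max_eq_left hy.le
    rwa [this.fderiv_eq]

theorem min (hψ : HasFiniteGradients ψ) (hχ : HasFiniteGradients χ) :
    HasFiniteGradients (fun x => min (ψ x) (χ x)) := by
  simpa [max_neg_neg] using (hψ.neg.max hχ.neg).neg

theorem norm : HasFiniteGradients (fun x : Fin d → ℝ => ‖x‖) := by
  have hcoord (i : Fin d) : HasFiniteGradients (fun x : Fin d → ℝ => x i) :=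
    clm (ContinuousLinearMap.proj i) (LipschitzWith.eval i)
  have key (s : Finset (Fin d)) :
      HasFiniteGradients (fun x : Fin d → ℝ => ((s.sup fun b => ‖x b‖₊ : NNReal) : ℝ)) := by
    classical
    induction s using Finset.induction_on with
    | empty => simpa using const 0
    | insert a s ha ih =>
      have h := ((hcoord a).max (hcoord a).neg).max ih
      convert h using 2 with x
      rw [Finset.sup_insert, NNReal.coe_max]
      rfl
  exact key Finset.univ

end HasFiniteGradients

theorem measurable_Dmat_apply {d : ℕ} (φ : (Fin d → ℝ) → (Fin d → ℝ)) (i j : Fin d) :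
    Measurable fun x => Dmat φ x i j :=
  (measurable_pi_apply i).comp (measurable_fderiv_apply_const ℝ φ (Pi.single j 1))

theorem measurable_Dmat {d : ℕ} (φ : (Fin d → ℝ) → (Fin d → ℝ)) :
    Measurable (Dmat φ) := by
  have h1 : Measurable fun x => (fun i j => Dmat φ x i j : Fin d → Fin d → ℝ) :=
    measurable_pi_lambda _ fun i => measurable_pi_lambda _ fun j => measurable_Dmat_apply φ i j
  have h2 : Measurable (fun A : Fin d → Fin d → ℝ => (Matrix.of A : Mat d)) :=
    (show Continuous (fun A : Fin d → Fin d → ℝ => (Matrix.of A : Mat d)) from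
      continuous_id).measurable
  exact h2.comp h1

theorem abs_Dmat_apply_le {d : ℕ} {φ : (Fin d → ℝ) → (Fin d → ℝ)} {L : NNReal}
    (hφ : LipschitzWith L φ) (x : Fin d → ℝ) (i j : Fin d) : |Dmat φ x i j| ≤ L := by
  calc |Dmat φ x i j| ≤ ‖fderiv ℝ φ x (Pi.single j 1)‖ :=
        norm_le_pi_norm (fderiv ℝ φ x (Pi.single j 1)) i
    _ ≤ ‖fderiv ℝ φ x‖ * ‖(Pi.single j 1 : Fin d → ℝ)‖ := ContinuousLinearMap.le_opNorm _ _
    _ ≤ L * 1 := by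
        gcongr
        · exact norm_fderiv_le_of_lipschitz ℝ hφ
        · simp [Pi.norm_single]
    _ = L := mul_one _

theorem Dmat_apply {d : ℕ} {φ : (Fin d → ℝ) → (Fin d → ℝ)} {x : Fin d → ℝ}
    (h : ∀ i, DifferentiableAt ℝ (fun y => φ y i) x) (i j : Fin d) :
    Dmat φ x i j = fderiv ℝ (fun y => φ y i) x (Pi.single j 1) := by
  have := fderiv_pi (𝕜 := ℝ) (φ := fun i y => φ y i) (x := x) h
  change fderiv ℝ (fun y i => φ y i) x (Pi.single j 1) i = _
  rw [this]
  rfl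

/-- If the matrix derivative takes finitely many values a.e., then any function of it is
integrable on sets of finite measure. -/
theorem integrableOn_comp_Dmat_of_finite {d : ℕ} {φ : (Fin d → ℝ) → (Fin d → ℝ)}
    {T : Set (Mat d)} (hT : T.Finite) (hφ : ∀ᵐ x, Dmat φ x ∈ T) (k : Mat d → ℝ)
    {U : Set (Fin d → ℝ)} (hU : volume U ≠ ⊤) :
    IntegrableOn (fun x => k (Dmat φ x)) U := by
  classical
  have hset (A : Mat d) : MeasurableSet {x | Dmat φ x = A} := by
    have : {x | Dmat φ x = A} = ⋂ i, ⋂ j, {x | Dmat φ x i j = A i j} := by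
      ext x
      simp [← Matrix.ext_iff]
    rw [this]
    exact MeasurableSet.iInter fun i => MeasurableSet.iInter fun j =>
      measurable_Dmat_apply φ i j (measurableSet_singleton _)
  have hint : IntegrableOn
      (fun x => ∑ A ∈ hT.toFinset, {x | Dmat φ x = A}.indicator (fun _ => k A) x) U :=
    integrable_finsetSum _ fun A _ =>
      (integrableOn_const (C := k A) hU).indicator (hset A)
  refine hint.congr (ae_restrict_of_ae ?_)
  filter_upwards [hφ] with x hx
  rw [Finset.sum_eq_single (Dmat φ x)]
  · simp
  · intro A _ hA
    exact Set.indicator_of_notMem (fun h => hA h.symm) _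
  · intro h
    exact absurd (hT.mem_toFinset.2 hx) h

/-- A piecewise affine cut-off of a linear map with small coefficients. -/
theorem exists_cutoff {d : ℕ} (M : Mat d) {δ : ℝ} (hδ : 0 < δ) (hδ' : δ < 1 / 2)
    (hM : ∀ i, ∑ j, |M i j| ≤ δ) :
    ∃ φ : (Fin d → ℝ) → (Fin d → ℝ), LipschitzWith 1 φ ∧ HasCompactSupport φ ∧
      tsupport φ ⊆ Metric.ball 0 1 ∧
      (∃ T : Set (Mat d), T.Finite ∧ ∀ᵐ x, Dmat φ x ∈ T) ∧
      ∀ x ∈ Metric.ball (0 : Fin d → ℝ) (1 - 2 * δ), Dmat φ x = M := by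
  let ℓ (i : Fin d) : (Fin d → ℝ) →L[ℝ] ℝ := ∑ j, M i j • ContinuousLinearMap.proj j
  have hℓ (i : Fin d) (x : Fin d → ℝ) : ℓ i x = ∑ j, M i j * x j := by
    simp [ℓ]
  have hbound (i : Fin d) (x : Fin d → ℝ) : |ℓ i x| ≤ δ * ‖x‖ := by
    rw [hℓ]
    calc |∑ j, M i j * x j| ≤ ∑ j, |M i j * x j| := Finset.abs_sum_le_sum_abs _ _
      _ ≤ ∑ j, |M i j| * ‖x‖ := by
          gcongr with j
          rw [abs_mul]
          gcongr
          exact norm_le_pi_norm x j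
      _ = (∑ j, |M i j|) * ‖x‖ := by rw [Finset.sum_mul]
      _ ≤ δ * ‖x‖ := by gcongr; exact hM i
  have hℓLip (i : Fin d) : LipschitzWith 1 (ℓ i) := by
    refine LipschitzWith.of_dist_le_mul fun x y => ?_
    rw [dist_eq_norm, dist_eq_norm, ← map_sub]
    refine (hbound i (x - y)).trans ?_
    gcongr
    norm_num
    linarith
  let p (x : Fin d → ℝ) : ℝ := max 0 (1 - δ - ‖x‖)
  have hp0 (x) : 0 ≤ p x := le_max_left _ _
  have hp : HasFiniteGradients p :=
    (HasFiniteGradients.const 0).max (HasFiniteGradients.norm.const_sub (1 - δ))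
  let φ (x : Fin d → ℝ) (i : Fin d) : ℝ := max (-p x) (min (ℓ i x) (p x))
  have hφi (i : Fin d) : HasFiniteGradients (fun x => φ x i) :=
    hp.neg.max ((HasFiniteGradients.clm (ℓ i) (hℓLip i)).min hp)
  have hsupp : tsupport φ ⊆ Metric.closedBall 0 (1 - δ) := by
    refine closure_minimal ?_ Metric.isClosed_closedBall
    intro x hx
    by_contra hxn
    rw [mem_closedBall_zero_iff, not_le] at hxn
    apply hx
    have hpx : p x = 0 := max_eq_left (by linarith)
    funext i
    simp [φ, hpx]
  refine ⟨φ, ?_, ?_, ?_, ?_, ?_⟩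
  · refine LipschitzWith.of_dist_le_mul fun x y => ?_
    rw [dist_pi_le_iff (by positivity)]
    exact fun i => (hφi i).1.dist_le_mul x y
  · exact HasCompactSupport.of_support_subset_isCompact (isCompact_closedBall 0 (1 - δ))
      ((subset_tsupport φ).trans hsupp)
  · exact hsupp.trans (Metric.closedBall_subset_ball (by linarith))
  · choose S hS hSae using fun i => (hφi i).2
    refine ⟨(fun L : Fin d → ((Fin d → ℝ) →L[ℝ] ℝ) =>
      (Matrix.of fun i j => L i (Pi.single j 1) : Mat d)) '' Set.pi Set.univ S,
      (Set.Finite.pi hS).image _, ?_⟩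
    filter_upwards [ae_all_iff.2 hSae, ae_all_iff.2 fun i => (hφi i).1.ae_differentiableAt]
      with x hx hdx
    refine ⟨fun i => fderiv ℝ (fun y => φ y i) x, fun i _ => hx i, ?_⟩
    ext i j
    exact (Dmat_apply hdx i j).symm
  · intro x hx
    have heq (i : Fin d) : (fun y => φ y i) =ᶠ[nhds x] ℓ i := by
      filter_upwards [Metric.isOpen_ball.mem_nhds hx] with y hy
      rw [mem_ball_zero_iff] at hy
      have h1 : δ ≤ p y := le_max_of_le_right (by linarith)
      have h2 : |ℓ i y| ≤ δ := (hbound i y).trans (by nlinarith)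
      obtain ⟨h3, h4⟩ := abs_le.1 h2
      change max (-p y) (min (ℓ i y) (p y)) = ℓ i y
      rw [min_eq_left (by linarith), max_eq_right (by linarith)]
    ext i j
    rw [Dmat_apply (fun i => ((ℓ i).differentiableAt).congr_of_eventuallyEq (heq i)),
      (heq i).fderiv_eq, ContinuousLinearMap.fderiv, hℓ]
    simp [Pi.single_apply]

/-- Quantitative continuity of a quasiconvex function with a local upper bound. -/
theorem IsQuasiconvex.sub_mul_pow_le {d : ℕ} {g : Mat d → ℝ} (hg : IsQuasiconvex g)
    {F M : Mat d} {C δ : ℝ} (hC : ∀ A : Mat d, (∀ i j, |A i j| ≤ 1) → g (F + A) ≤ C)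
    (hδ : 0 < δ) (hδ' : δ < 1 / 2) (hM : ∀ i, ∑ j, |M i j| ≤ δ) :
    (C - g (F + M)) * (1 - 2 * δ) ^ d ≤ C - g F := by
  obtain ⟨φ, hLip, hcs, hsupp, ⟨T, hT, hTae⟩, hφM⟩ := exists_cutoff M hδ hδ' hM
  have hvol (r : ℝ) (hr : 0 < r) :
      volume.real (Metric.ball (0 : Fin d → ℝ) r) = (2 * r) ^ d := by
    rw [Measure.real, Real.volume_pi_ball _ hr, ENNReal.toReal_ofReal (by positivity),
      Fintype.card_fin]
  have hfin : volume (Metric.ball (0 : Fin d → ℝ) 1) ≠ ⊤ := measure_ball_lt_top.ne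
  have hq := hg _ Metric.isOpen_ball Metric.isBounded_ball F φ ⟨1, hLip⟩ hcs hsupp
  have hint : IntegrableOn (fun x => g (F + Dmat φ x)) (Metric.ball 0 1) :=
    integrableOn_comp_Dmat_of_finite hT hTae (fun A => g (F + A)) hfin
  have hconst : IntegrableOn (fun _ : Fin d → ℝ => C) (Metric.ball 0 1) :=
    integrableOn_const hfin
  have hsub : Metric.ball (0 : Fin d → ℝ) (1 - 2 * δ) ⊆ Metric.ball 0 1 :=
    Metric.ball_subset_ball (by linarith)
  have h1 : ∫ x in Metric.ball (0 : Fin d → ℝ) (1 - 2 * δ), (C - g (F + Dmat φ x)) =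
      (C - g (F + M)) * (2 * (1 - 2 * δ)) ^ d := by
    rw [setIntegral_congr_fun (g := fun _ => C - g (F + M)) measurableSet_ball
      (fun x hx => by simp only [hφM x hx]), setIntegral_const, hvol _ (by linarith),
      smul_eq_mul, mul_comm]
  have h2 : ∫ x in Metric.ball (0 : Fin d → ℝ) (1 - 2 * δ), (C - g (F + Dmat φ x)) ≤
      ∫ x in Metric.ball (0 : Fin d → ℝ) 1, (C - g (F + Dmat φ x)) := by
    refine setIntegral_mono_set (hconst.sub hint) ?_ hsub.eventuallyLE
    refine Filter.Eventually.of_forall fun x => ?_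
    exact sub_nonneg.2 (hC _ fun i j => by simpa using abs_Dmat_apply_le hLip x i j)
  have h3 : ∫ x in Metric.ball (0 : Fin d → ℝ) 1, (C - g (F + Dmat φ x)) =
      C * 2 ^ d - ∫ x in Metric.ball (0 : Fin d → ℝ) 1, g (F + Dmat φ x) := by
    rw [integral_sub hconst hint, setIntegral_const, hvol _ one_pos, smul_eq_mul]
    ring
  change g F * volume.real _ ≤ _ at hq
  rw [hvol _ one_pos, mul_one] at hq
  rw [h1, h3, mul_pow] at h2
  have h4 : (0 : ℝ) < 2 ^ d := by positivity
  refine le_of_mul_le_mul_right ?_ h4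
  linarith

theorem isCompact_setOf_abs_sub_le {d : ℕ} (F : Mat d) (R : ℝ) :
    IsCompact {A : Mat d | ∀ i j, |A i j - F i j| ≤ R} := by
  have h : IsCompact (Set.pi Set.univ fun i : Fin d => Set.pi Set.univ fun j : Fin d =>
      Metric.closedBall (F i j) R) :=
    isCompact_univ_pi fun i => isCompact_univ_pi fun j => isCompact_closedBall _ _
  have heq : {A : Mat d | ∀ i j, |A i j - F i j| ≤ R} =
      (Set.pi Set.univ fun i : Fin d => Set.pi Set.univ fun j : Fin d =>
        Metric.closedBall (F i j) R) := by
    ext A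
    change _ ↔ ∀ i ∈ Set.univ, ∀ j ∈ Set.univ, A i j ∈ Metric.closedBall (F i j) R
    simp [Real.dist_eq]
  rw [heq]
  exact h

theorem IsQuasiconvex.lowerSemicontinuous {d : ℕ} {g : Mat d → ℝ} (hg : IsQuasiconvex g)
    (hbdd : ∀ K : Set (Mat d), IsCompact K → ∃ C, ∀ A ∈ K, g A ≤ C) :
    LowerSemicontinuous g := by
  intro F y hy
  obtain ⟨C, hC⟩ := hbdd _ (isCompact_setOf_abs_sub_le F 1)
  have hC' (A : Mat d) (hA : ∀ i j, |A i j| ≤ 1) : g (F + A) ≤ C :=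
    hC _ fun i j => by simpa using hA i j
  have hlim : Filter.Tendsto (fun δ : ℝ => (C - y) * (1 - 2 * δ) ^ d) (nhdsWithin 0 (Set.Ioi 0))
      (nhds (C - y)) := by
    have : Continuous (fun δ : ℝ => (C - y) * (1 - 2 * δ) ^ d) := by fun_prop
    simpa using (this.tendsto 0).mono_left nhdsWithin_le_nhds
  obtain ⟨δ, h1, h2, h3⟩ := ((hlim.eventually_const_lt (sub_lt_sub_left hy C)).and
    (Ioo_mem_nhdsGT (show (0 : ℝ) < 1 / 2 by norm_num))).exists
  have hcont (i : Fin d) : ∀ᶠ A : Mat d in nhds F, ∑ j, |(A - F) i j| < δ := by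
    have hc : Continuous fun A : Mat d => ∑ j, |(A - F) i j| :=
      continuous_finsetSum _ fun j _ => ((continuous_id.sub continuous_const).matrix_elem i j).abs
    exact hc.continuousAt.eventually_lt_const (by simpa using h2)
  filter_upwards [Filter.eventually_all.2 hcont] with A hA
  have h4 := hg.sub_mul_pow_le hC' h2 h3 fun i => (hA i).le
  rw [add_sub_cancel] at h4
  have h5 := lt_of_mul_lt_mul_right (h4.trans_lt h1)
    (pow_nonneg (by linarith : (0 : ℝ) ≤ 1 - 2 * δ) d)
  linarith

theorem integrableOn_comp_add_Dmat {d : ℕ} {k : Mat d → ℝ} (hk : LowerSemicontinuous k)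
    (hbdd : ∀ K : Set (Mat d), IsCompact K → ∃ C, ∀ A ∈ K, k A ≤ C)
    {φ : (Fin d → ℝ) → (Fin d → ℝ)} {L : NNReal} (hφ : LipschitzWith L φ) (F : Mat d)
    {U : Set (Fin d → ℝ)} (hU : volume U ≠ ⊤) :
    IntegrableOn (fun x => k (F + Dmat φ x)) U := by
  have hK := isCompact_setOf_abs_sub_le F L
  obtain ⟨C, hC⟩ := hbdd _ hK
  obtain ⟨c, hc⟩ := (hk.lowerSemicontinuousOn _).bddBelow_of_isCompact hK
  have hmem (x) : F + Dmat φ x ∈ {A : Mat d | ∀ i j, |A i j - F i j| ≤ L} := fun i j => by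
    simpa using abs_Dmat_apply_le hφ x i j
  have hmeas : Measurable fun x => k (F + Dmat φ x) :=
    (LowerSemicontinuous.comp hk (continuous_const.add continuous_id :
      Continuous fun A => F + A)).measurable.comp (measurable_Dmat φ)
  refine Measure.integrableOn_of_bounded (M := max |c| |C|) hU hmeas.aestronglyMeasurable
    (Filter.Eventually.of_forall fun x => ?_)
  exact abs_le_max_abs_abs (hc ⟨_, hmem x, rfl⟩) (hC _ (hmem x))

/-- The supremum of `g` over all translates by skew-symmetric matrices. -/
def skewSup {d : ℕ} (g : Mat d → ℝ) (F : Mat d) : ℝ := ⨆ G : Mat d, g (F + (G - Gᵀ))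

theorem skewSup_add_skew {d : ℕ} (g : Mat d → ℝ) (F B : Mat d) :
    skewSup g (F + (B - Bᵀ)) = skewSup g F := by
  unfold skewSup
  rw [← (Equiv.addLeft B).iSup_comp (g := fun G : Mat d => g (F + (G - Gᵀ)))]
  congr 1
  funext G
  congr 1
  simp only [Equiv.coe_addLeft, Matrix.transpose_add]
  abel

theorem skewSup_symPart_add {d : ℕ} (g : Mat d → ℝ) (A F : Mat d) :
    skewSup g (A + symPart F) = skewSup g (A + F) := by
  rw [← skewSup_add_skew g (A + symPart F) ((1 / 2 : ℝ) • F)]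
  congr 1
  ext i j
  simp [symPart]
  ring

theorem symPt_add_skew {d : ℕ} (F G : Mat d) : symPt (F + (G - Gᵀ)) = symPt F := by
  apply Subtype.ext
  ext i j
  simp [symPt, symPart]
  ring

theorem symPt_coe {d : ℕ} (E : SymMat d) : symPt E.1 = E := by
  apply Subtype.ext
  have h : (E.1)ᵀ = E.1 := E.2
  ext i j
  simp [symPt, symPart, h]
  ring

theorem IsQuasiconvexOnLinearStrains.isQuasiconvex {d : ℕ} {h : SymMat d → ℝ}
    (hh : IsQuasiconvexOnLinearStrains h) : IsQuasiconvex fun F => h (symPt F) := by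
  intro U hU hUb F φ hφ hcs hsupp
  refine (hh U hU hUb (symPt F) φ hφ hcs hsupp).trans_eq ?_
  congr 1
  funext x
  congr 1
  apply Subtype.ext
  ext i j
  simp [symPt, symPart]
  ring

theorem isQuasiconvexOnLinearStrains_skewSup {d : ℕ} {g : Mat d → ℝ} (hg : IsQuasiconvex g)
    {V : SymMat d → ℝ} (hgV : ∀ F, g F ≤ V (symPt F))
    (hV : ∀ K : Set (Mat d), IsCompact K → ∃ C, ∀ A ∈ K, V (symPt A) ≤ C) :
    IsQuasiconvexOnLinearStrains fun E => skewSup g E.1 := by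
  have hle (F G : Mat d) : g (F + (G - Gᵀ)) ≤ V (symPt F) := by
    simpa [symPt_add_skew] using hgV (F + (G - Gᵀ))
  have hbdd (F : Mat d) : BddAbove (Set.range fun G : Mat d => g (F + (G - Gᵀ))) :=
    ⟨V (symPt F), by rintro _ ⟨G, rfl⟩; exact hle F G⟩
  have hgbdd (K : Set (Mat d)) (hK : IsCompact K) : ∃ C, ∀ A ∈ K, g A ≤ C :=
    (hV K hK).imp fun C hC A hA => (hgV A).trans (hC A hA)
  have hSbdd (K : Set (Mat d)) (hK : IsCompact K) : ∃ C, ∀ A ∈ K, skewSup g A ≤ C :=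
    (hV K hK).imp fun C hC A hA => (ciSup_le (hle A)).trans (hC A hA)
  have hglsc := hg.lowerSemicontinuous hgbdd
  have hSlsc : LowerSemicontinuous (skewSup g) :=
    lowerSemicontinuous_ciSup hbdd fun G => LowerSemicontinuous.comp hglsc
      (continuous_id.add continuous_const)
  rintro U hU hUb E φ ⟨L, hφ⟩ hcs hsupp
  have hfin : volume U ≠ ⊤ := hUb.measure_lt_top.ne
  simp only [skewSup_symPart_add]
  rw [skewSup, Real.iSup_mul_of_nonneg ENNReal.toReal_nonneg]
  refine ciSup_le fun G => ?_
  refine (hg U hU hUb _ φ ⟨L, hφ⟩ hcs hsupp).trans ?_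
  refine integral_mono (integrableOn_comp_add_Dmat hglsc hgbdd hφ _ hfin)
    (integrableOn_comp_add_Dmat hSlsc hSbdd hφ _ hfin) fun x => ?_
  refine le_trans (le_of_eq ?_) (le_ciSup (hbdd (E.1 + Dmat φ x)) G)
  simp only
  congr 1
  abel

theorem exists_bound_on_compact {d : ℕ} {V : SymMat d → ℝ}
    (hVloc : ∀ A : SymMat d, ∃ r > (0 : ℝ), ∃ C : ℝ,
      ∀ B : SymMat d, frob (B.1 - A.1) ≤ r → |V B| ≤ C)
    (K : Set (Mat d)) (hK : IsCompact K) : ∃ C, ∀ A ∈ K, V (symPt A) ≤ C := by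
  refine hK.induction_on (p := fun K => ∃ C, ∀ A ∈ K, V (symPt A) ≤ C) ⟨0, by simp⟩
    (fun s t hst ⟨C, hC⟩ => ⟨C, fun A hA => hC A (hst hA)⟩) ?_ ?_
  · rintro s t ⟨C, hC⟩ ⟨C', hC'⟩
    refine ⟨max C C', ?_⟩
    rintro A (hA | hA)
    · exact le_max_of_le_left (hC A hA)
    · exact le_max_of_le_right (hC' A hA)
  · intro A _
    obtain ⟨r, hr, C, hC⟩ := hVloc (symPt A)
    have hsym : Continuous fun B : Mat d => symPart B - symPart A := by
      unfold symPart
      fun_prop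
    have hcont : Continuous fun B : Mat d => frob (symPart B - symPart A) :=
      Real.continuous_sqrt.comp (continuous_finsetSum _ fun i _ =>
        continuous_finsetSum _ fun j _ => (hsym.matrix_elem i j).pow 2)
    have hev : ∀ᶠ B in nhds A, frob (symPart B - symPart A) < r :=
      hcont.continuousAt.eventually_lt_const (by simpa [frob] using hr)
    exact ⟨_, mem_nhdsWithin_of_mem_nhds hev, C, fun B hB =>
      (le_abs_self _).trans (hC (symPt B) (le_of_lt hB))⟩

/-- for `V` locally bounded and Borel measurable on the symmetric matrices
and `f(F) := V(sym F)`, one has `f^{qc}(F) = V^{qce}(sym F)` for every `F`. -/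
theorem qcEnvelope_eq_qceEnvelope (d : ℕ) (hd : 1 ≤ d)
    (V : SymMat d → ℝ) (hVmeas : Measurable V)
    (hVloc : ∀ A : SymMat d, ∃ r > (0 : ℝ), ∃ C : ℝ,
      ∀ B : SymMat d, frob (B.1 - A.1) ≤ r → |V B| ≤ C) :
    ∀ F : Mat d, qcEnvelope (fun G : Mat d => V (symPt G)) F = qceEnvelope V (symPt F) := by
  intro F
  apply le_antisymm
  · refine sSup_le ?_
    rintro y ⟨g, hg, hgV, rfl⟩
    have hle (F G : Mat d) : g (F + (G - Gᵀ)) ≤ V (symPt F) := by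
      simpa [symPt_add_skew] using hgV (F + (G - Gᵀ))
    have h1 : g F ≤ skewSup g (symPt F).1 := by
      have h2 := skewSup_symPart_add g 0 F
      simp only [zero_add] at h2
      change g F ≤ skewSup g (symPart F)
      rw [h2]
      refine le_trans (le_of_eq ?_) (le_ciSup ⟨V (symPt F), ?_⟩ (0 : Mat d))
      · simp
      · rintro _ ⟨G, rfl⟩
        exact hle F G
    refine (EReal.coe_le_coe_iff.2 h1).trans (le_sSup ⟨fun E => skewSup g E.1,
      isQuasiconvexOnLinearStrains_skewSup hg hgV (exists_bound_on_compact hVloc),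
      fun E => ?_, rfl⟩)
    refine (ciSup_le (hle E.1)).trans_eq ?_
    rw [symPt_coe]
  · refine sSup_le ?_
    rintro y ⟨h, hh, hhV, rfl⟩
    exact le_sSup ⟨fun G => h (symPt G), hh.isQuasiconvex, fun G => hhV _, rfl⟩
end
end

section
/- Let d ≥ 1, let V be a locally bounded Borel measurable real-valued function on the d×d real symmetric matrices, and let U ⊂ ℝ^d be a bounded open set whose boundary has Lebesgue measure zero. Define the quasiconvexification on linear strains V^{qce}(E) := sup { h(E) : h real-valued on symmetric matrices, quasiconvex on linear strains, h ≤ V }, the supremum taken in ℝ ∪ {−∞}. Then for every d×d real symmetric matrix E, V^{qce}(E) = inf_φ (1/|U|) ∫_U V(E + e(φ)(x)) dx, where the infimum is over all Lipschitz maps φ : ℝ^d → ℝ^d with compact support contained in U, and e(φ) := sym(Dφ). Here h is quasiconvex on linear strains means: for every bounded open set U' ⊂ ℝ^d, every symmetric E', and every Lipschitz map ψ : ℝ^d → ℝ^d with compact support contained in U', h(E')·|U'| ≤ ∫_{U'} h(E' + e(ψ)(x)) dx. -/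
open Matrix MeasureTheory

noncomputable section

namespace StrainEnvelope

open Set Filter Topology Metric

/-- The space `ℝ^d` (with the sup norm). -/
abbrev Vec (d : ℕ) := Fin d → ℝ

/-- Linear endomorphisms of `ℝ^d`, as the values of derivatives of deformations. -/
abbrev Lin (d : ℕ) := Vec d →L[ℝ] Vec d

variable {d : ℕ}

/-- Lipschitz maps with compact support in `U`. -/
structure IsTest (U : Set (Vec d)) (φ : Vec d → Vec d) : Prop where
  lipschitz : ∃ L : NNReal, LipschitzWith L φ
  compact : HasCompactSupport φ
  subset : tsupport φ ⊆ U

/-- Boundedness on bounded sets of gradients. -/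
def BddOnBdd (W : Lin d → ℝ) : Prop := ∀ R : ℝ, ∃ C : ℝ, ∀ G, ‖G‖ ≤ R → |W G| ≤ C

/-- Every value of `ζ` is, up to an arbitrarily small error, at least the average of `W` over
some perturbation of the constant gradient on the unit cube. -/
def HasTests (W ζ : Lin d → ℝ) : Prop :=
  ∀ B, ∀ ε > 0, ∃ φ, IsTest (ball 0 1) φ ∧
    ∫ x in ball 0 1, W (B + fderiv ℝ φ x) ≤ volume.real (ball (0 : Vec d) 1) * (ζ B + ε)

theorem IsTest.of_isBounded {U : Set (Vec d)} (hU : Bornology.IsBounded U) {φ : Vec d → Vec d}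
    {L : NNReal} (hL : LipschitzWith L φ) (h : tsupport φ ⊆ U) : IsTest U φ :=
  ⟨⟨L, hL⟩, Metric.isCompact_of_isClosed_isBounded (isClosed_tsupport φ) (hU.subset h), h⟩

theorem IsTest.mono {U U' : Set (Vec d)} (h : U ⊆ U') {φ : Vec d → Vec d} (hφ : IsTest U φ) :
    IsTest U' φ :=
  ⟨hφ.lipschitz, hφ.compact, hφ.subset.trans h⟩

theorem isTest_zero (U : Set (Vec d)) : IsTest U (0 : Vec d → Vec d) :=
  ⟨⟨0, LipschitzWith.const 0⟩, HasCompactSupport.zero, by simp [tsupport]⟩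

theorem tsupport_subset_of_eq_zero {φ : Vec d → Vec d} {s : Set (Vec d)} (hs : IsClosed s)
    (h : ∀ x, x ∉ s → φ x = 0) : tsupport φ ⊆ s :=
  closure_minimal (fun x hx => by by_contra hxs; exact hx (h x hxs)) hs

theorem fderiv_eq_zero_of_notMem_tsupport {φ : Vec d → Vec d} {x : Vec d} (hx : x ∉ tsupport φ) :
    fderiv ℝ φ x = 0 := by
  have : φ =ᶠ[𝓝 x] fun _ => 0 := notMem_tsupport_iff_eventuallyEq.mp hx
  rw [this.fderiv_eq]; simp

theorem measurable_comp_fderiv {W : Lin d → ℝ} (hW : Measurable W) (A : Lin d)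
    (φ : Vec d → Vec d) : Measurable fun x => W (A + fderiv ℝ φ x) :=
  hW.comp ((continuous_const.add continuous_id).measurable.comp (measurable_fderiv ℝ φ))

theorem norm_add_fderiv_le {A : Lin d} {L : NNReal} {φ : Vec d → Vec d} (hφ : LipschitzWith L φ)
    (x : Vec d) : ‖A + fderiv ℝ φ x‖ ≤ ‖A‖ + L :=
  (norm_add_le _ _).trans (by gcongr; exact norm_fderiv_le_of_lipschitz ℝ hφ)

theorem integrableOn_comp_fderiv {W : Lin d → ℝ} (hW : Measurable W) (hb : BddOnBdd W) (A : Lin d)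
    {L : NNReal} {φ : Vec d → Vec d} (hφ : LipschitzWith L φ) {s : Set (Vec d)}
    (hs : volume s ≠ ⊤) : IntegrableOn (fun x => W (A + fderiv ℝ φ x)) s := by
  obtain ⟨C, hC⟩ := hb (‖A‖ + L)
  refine Measure.integrableOn_of_bounded (M := C) hs
    (measurable_comp_fderiv hW A φ).aestronglyMeasurable (ae_of_all _ fun x => ?_)
  exact hC _ (norm_add_fderiv_le hφ x)

/-- The blow-down of `φ` to scale `s` around `x`. -/
def rescale (x : Vec d) (s : ℝ) (φ : Vec d → Vec d) (y : Vec d) : Vec d := s • φ (s⁻¹ • (y - x))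

theorem lipschitzWith_rescale {L : NNReal} {φ : Vec d → Vec d} (hφ : LipschitzWith L φ)
    (x : Vec d) {s : ℝ} (hs : 0 < s) : LipschitzWith L (rescale x s φ) := by
  refine LipschitzWith.of_dist_le_mul fun y z => ?_
  have h := hφ.dist_le_mul (s⁻¹ • (y - x)) (s⁻¹ • (z - x))
  rw [dist_smul₀, dist_sub_right, Real.norm_of_nonneg (inv_pos.2 hs).le] at h
  rw [rescale, rescale, dist_smul₀, Real.norm_of_nonneg hs.le]
  calc _ ≤ s * (L * (s⁻¹ * dist y z)) := by gcongr
    _ = _ := by field_simp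

theorem tsupport_rescale_subset (x : Vec d) (s : ℝ) (φ : Vec d → Vec d) :
    tsupport (rescale x s φ) ⊆ (fun y => s⁻¹ • (y - x)) ⁻¹' tsupport φ := by
  refine closure_minimal (fun y hy => subset_tsupport φ ?_)
    ((isClosed_tsupport φ).preimage (by fun_prop))
  intro h
  exact hy (by simp [rescale, h])

theorem fderiv_rescale (x : Vec d) {s : ℝ} (hs : 0 < s) (φ : Vec d → Vec d) (y : Vec d) :
    fderiv ℝ (rescale x s φ) y = fderiv ℝ φ (s⁻¹ • (y - x)) := by
  have h1 : rescale x s φ = s • fun y => (fun z => φ (s⁻¹ • z)) (y - x) := rfl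
  rw [h1, fderiv_const_smul_field, Pi.smul_apply,
    fderiv_comp_sub (f := fun z => φ (s⁻¹ • z)), fderiv_comp_smul,
    smul_smul, mul_inv_cancel₀ hs.ne', one_smul]

theorem preimage_ball_rescale (x : Vec d) {s : ℝ} (hs : 0 < s) :
    (fun y => s⁻¹ • (y - x)) ⁻¹' ball 0 1 = ball x s := by
  ext y
  simp [norm_smul, abs_of_pos hs, dist_eq_norm, inv_mul_lt_iff₀ hs]

theorem isTest_rescale {φ : Vec d → Vec d} (hφ : IsTest (ball 0 1) φ) (x : Vec d) {s : ℝ}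
    (hs : 0 < s) : IsTest (ball x s) (rescale x s φ) := by
  obtain ⟨L, hL⟩ := hφ.lipschitz
  refine .of_isBounded isBounded_ball (lipschitzWith_rescale hL x hs) ?_
  rw [← preimage_ball_rescale x hs]
  exact (tsupport_rescale_subset x s φ).trans (preimage_mono hφ.subset)

theorem setIntegral_ball_rescale (f : Vec d → ℝ) (x : Vec d) {s : ℝ} (hs : 0 < s) :
    ∫ y in ball x s, f (s⁻¹ • (y - x)) = s ^ d * ∫ y in ball 0 1, f y := by
  rw [← integral_indicator measurableSet_ball, ← integral_indicator measurableSet_ball]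
  have h : (ball x s).indicator (fun y => f (s⁻¹ • (y - x))) =
      fun y => (fun z => (ball 0 1).indicator f (s⁻¹ • z)) (y - x) := by
    rw [← preimage_ball_rescale x hs]
    rfl
  rw [h, integral_sub_right_eq_self (fun z => (ball 0 1).indicator f (s⁻¹ • z)),
    Measure.integral_comp_smul]
  simp [abs_of_pos hs]

theorem volume_real_ball (x : Vec d) {s : ℝ} (hs : 0 < s) :
    volume.real (ball x s) = s ^ d * volume.real (ball (0 : Vec d) 1) := by
  rw [Measure.real, Measure.addHaar_ball_of_pos _ _ hs]
  simp [Measure.real, ENNReal.toReal_ofReal (pow_nonneg hs.le d)]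

theorem volume_real_closedBall (x : Vec d) {s : ℝ} (hs : 0 < s) :
    volume.real (closedBall x s) = s ^ d * volume.real (ball (0 : Vec d) 1) := by
  rw [Measure.addHaar_real_closedBall _ _ hs.le]; simp

theorem volume_real_ball_pos : 0 < volume.real (ball (0 : Vec d) 1) :=
  ENNReal.toReal_pos (measure_ball_pos _ _ one_pos).ne' measure_ball_lt_top.ne

/-- Truncation of the components of `u` to `[-g, g]`. -/
def clamp (u : Vec d → Vec d) (g : Vec d → ℝ) (x : Vec d) : Vec d :=
  fun i => max (-g x) (min (g x) (u x i))

theorem lipschitzWith_apply {K : NNReal} {u : Vec d → Vec d} (hu : LipschitzWith K u) (i : Fin d) :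
    LipschitzWith K fun x => u x i :=
  LipschitzWith.of_dist_le_mul fun x y => (dist_le_pi_dist _ _ i).trans (hu.dist_le_mul x y)

theorem lipschitzWith_clamp {K c : NNReal} {u : Vec d → Vec d} {g : Vec d → ℝ}
    (hu : LipschitzWith K u) (hg : LipschitzWith c g) : LipschitzWith (max K c) (clamp u g) := by
  refine LipschitzWith.of_dist_le_mul fun x y => (dist_pi_le_iff (by positivity)).2 fun i => ?_
  have h := (hg.neg.max (hg.min (lipschitzWith_apply hu i))).weaken (K' := max K c)
    (max_le (le_max_right _ _) (max_le (le_max_right _ _) (le_max_left _ _)))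
  exact h.dist_le_mul x y

/-- The tent of slope `c` over the ball of radius `ρ`. -/
def tent (x : Vec d) (c ρ : ℝ) (y : Vec d) : ℝ := max 0 (c * (ρ - ‖y - x‖))

theorem lipschitzWith_tent (x : Vec d) (c : NNReal) (ρ : ℝ) : LipschitzWith c (tent x c ρ) := by
  have h : LipschitzWith c fun y : Vec d => (c : ℝ) * (ρ - ‖y - x‖) := by
    refine LipschitzWith.of_dist_le_mul fun y z => ?_
    rw [Real.dist_eq, ← mul_sub, abs_mul, NNReal.abs_eq, dist_eq_norm, abs_sub_comm]
    gcongr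
    have := abs_norm_sub_norm_le (y - x) (z - x)
    rw [sub_sub_sub_cancel_right] at this
    simpa using this
  have hmax := (LipschitzWith.const (0 : ℝ)).max h
  rwa [max_eq_right zero_le] at hmax

/-- A Lipschitz cutoff of `u` that keeps the gradients bounded by that of `u` and `c`. -/
theorem clamp_tent_spec {u : Vec d → Vec d} (x : Vec d) {r t : ℝ} (hr : 0 < r) (ht : 0 < t)
    (c : NNReal) (hsmall : ∀ y ∈ ball x ((1 - t) * r), ‖u y‖ ≤ c * (t / 2 * r)) :
    tsupport (clamp u (tent x c ((1 - t / 2) * r))) ⊆ ball x r ∧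
      ∀ y ∈ ball x ((1 - t) * r), clamp u (tent x c ((1 - t / 2) * r)) y = u y := by
  constructor
  · refine (tsupport_subset_of_eq_zero (s := closedBall x ((1 - t / 2) * r)) isClosed_closedBall
      fun y hy => ?_).trans (closedBall_subset_ball (by nlinarith))
    rw [mem_closedBall, dist_eq_norm, not_le] at hy
    have : tent x c ((1 - t / 2) * r) y = 0 :=
      max_eq_left (mul_nonpos_of_nonneg_of_nonpos c.2 (by linarith))
    ext i
    simp [clamp, this]
  · intro y hy
    have h1 := hsmall y hy
    rw [mem_ball, dist_eq_norm] at hy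
    have h2 : c * (t / 2 * r) ≤ tent x c ((1 - t / 2) * r) y := by
      refine le_max_of_le_right ?_
      gcongr
      linarith
    ext i
    have h3 : |u y i| ≤ tent x c ((1 - t / 2) * r) y := ((norm_le_pi_norm (u y) i).trans h1).trans h2
    rw [abs_le] at h3
    rw [clamp, min_eq_right h3.2, max_eq_right h3.1]

theorem exists_one_sub_pow_le (d : ℕ) {η : ℝ} (hη : 0 < η) :
    ∃ t : ℝ, 0 < t ∧ t < 1 ∧ 1 - (1 - t) ^ d ≤ η := by
  have h : Tendsto (fun t : ℝ => 1 - (1 - t) ^ d) (𝓝[>] 0) (𝓝 0) := by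
    have : Continuous fun t : ℝ => 1 - (1 - t) ^ d := by fun_prop
    simpa using (this.tendsto 0).mono_left nhdsWithin_le_nhds
  obtain ⟨t, h1, h2⟩ := ((h.eventually_lt_const hη).and (Ioo_mem_nhdsGT one_pos)).exists
  exact ⟨t, h2.1, h2.2, h1.le⟩

/-- Near a point of differentiability, `ψ` can be modified on a small ball so that the energy on
this ball is controlled by any value achievable for the gradient at that point. -/
theorem exists_local_modification {W : Lin d → ℝ} (hW : Measurable W) (hb : BddOnBdd W)
    {A : Lin d} {L : NNReal} {ψ : Vec d → Vec d} (hψ : LipschitzWith L ψ) {x : Vec d}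
    (hx : DifferentiableAt ℝ ψ x) {z : ℝ}
    (hz : ∀ ε > 0, ∃ φ, IsTest (ball 0 1) φ ∧ ∫ y in ball 0 1, W (A + fderiv ℝ ψ x + fderiv ℝ φ y) ≤
      volume.real (ball (0 : Vec d) 1) * (z + ε))
    {ε : ℝ} (hε : 0 < ε) :
    ∃ r₀ > 0, ∀ r, 0 < r → r < r₀ → ∃ θ, IsTest (ball x r) θ ∧
      ∫ y in closedBall x r, W (A + fderiv ℝ (ψ + θ) y) ≤
        volume.real (closedBall x r) * (z + ε) := by
  set D := fderiv ℝ ψ x with hD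
  obtain ⟨M, hM⟩ := hb (‖A‖ + (L + max (‖D‖₊ + L) 1 : NNReal))
  have hM0 : 0 ≤ M := (abs_nonneg _).trans (hM 0 (by rw [norm_zero]; positivity))
  obtain ⟨t, ht0, ht1, ht⟩ := exists_one_sub_pow_le d
    (η := ε / 2 / (M + |z| + 1)) (by positivity)
  obtain ⟨φ, hφ, hφint⟩ := hz (ε / 2) (by positivity)
  have hsmall : ∀ᶠ y in 𝓝 x, ‖ψ y - ψ x - D (y - x)‖ ≤ t / 2 * ‖y - x‖ :=
    hx.hasFDerivAt.isLittleO.bound (by positivity)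
  obtain ⟨r₀, hr₀, hball⟩ := Metric.eventually_nhds_iff_ball.1 hsmall
  refine ⟨r₀, hr₀, fun r hr hrr => ?_⟩
  set s := (1 - t) * r with hs_def
  have hs : 0 < s := mul_pos (by linarith) hr
  have hsr : s < r := by nlinarith
  set u : Vec d → Vec d := fun y => D (y - x) - (ψ y - ψ x) with hu
  have hulip : LipschitzWith (‖D‖₊ + L) u := by
    have h1 : LipschitzWith ‖D‖₊ fun y => D (y - x) :=
      LipschitzWith.of_dist_le_mul fun y w => by
        simpa using D.lipschitz.dist_le_mul (y - x) (w - x)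
    have h2 : LipschitzWith L fun y => ψ y - ψ x := by
      simpa using hψ.sub (LipschitzWith.const (ψ x))
    exact h1.sub h2
  have husmall : ∀ y ∈ ball x ((1 - t) * r), ‖u y‖ ≤ (1 : NNReal) * (t / 2 * r) := by
    intro y hy
    have hyr : y ∈ ball x r := ball_subset_ball hsr.le hy
    have h1 := hball y (ball_subset_ball hrr.le hyr)
    rw [mem_ball, dist_eq_norm] at hyr
    rw [hu, norm_sub_rev, NNReal.coe_one, one_mul]
    exact h1.trans (by gcongr)
  obtain ⟨hsupp, heq⟩ := clamp_tent_spec x hr ht0 1 husmall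
  set θ := clamp u (tent x (1 : NNReal) ((1 - t / 2) * r)) with hθ
  have hθlip : LipschitzWith (max (‖D‖₊ + L) 1) θ :=
    lipschitzWith_clamp hulip (lipschitzWith_tent x 1 _)
  have hρ := isTest_rescale hφ x hs
  obtain ⟨K, hK⟩ := hρ.lipschitz
  set ρ := rescale x s φ with hρ_def
  have hsum : LipschitzWith (max (‖D‖₊ + L) 1 + K) (θ + ρ) := hθlip.add hK
  have htot : LipschitzWith (L + (max (‖D‖₊ + L) 1 + K)) (ψ + (θ + ρ)) := hψ.add hsum
  refine ⟨θ + ρ, .of_isBounded isBounded_ball hsum ?_, ?_⟩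
  · exact (tsupport_add θ ρ).trans
      (union_subset hsupp (hρ.subset.trans (ball_subset_ball hsr.le)))
  have hinner : ∫ y in ball x s, W (A + fderiv ℝ (ψ + (θ + ρ)) y) ≤
      s ^ d * (volume.real (ball (0 : Vec d) 1) * (z + ε / 2)) := by
    calc _ = ∫ y in ball x s, (fun w => W (A + D + fderiv ℝ φ w)) (s⁻¹ • (y - x)) := by
            refine setIntegral_congr_ae measurableSet_ball ?_
            filter_upwards [hK.ae_differentiableAt] with y hyd hy
            have h1 : ψ + (θ + ρ) =ᶠ[𝓝 y] fun w => (D (w - x) + ψ x) + ρ w := by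
              filter_upwards [isOpen_ball.mem_nhds hy] with w hw
              simp only [Pi.add_apply, heq w hw, hu]
              abel
            have h2 : HasFDerivAt (fun w => (D (w - x) + ψ x) + ρ w) (D + fderiv ℝ ρ y) y := by
              have h3 : HasFDerivAt (fun w => D (w - x) + ψ x) D y := by
                have := (D.hasFDerivAt (x := y - x)).comp y ((hasFDerivAt_id y).sub_const x)
                simpa using this.add_const (ψ x)
              exact h3.add hyd.hasFDerivAt
            rw [h1.fderiv_eq, h2.fderiv, hρ_def, fderiv_rescale x hs, add_assoc]
      _ = s ^ d * ∫ y in ball 0 1, W (A + D + fderiv ℝ φ y) :=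
            setIntegral_ball_rescale (fun w => W (A + D + fderiv ℝ φ w)) x hs
      _ ≤ _ := by gcongr
  have houter : ∫ y in closedBall x r \ ball x s, W (A + fderiv ℝ (ψ + (θ + ρ)) y) ≤
      M * volume.real (closedBall x r \ ball x s) := by
    refine (Real.le_norm_self _).trans (norm_setIntegral_le_of_norm_le_const
      ((measure_mono sdiff_subset).trans_lt measure_closedBall_lt_top) fun y hy => ?_)
    have h1 : ρ =ᶠ[𝓝 y] 0 := notMem_tsupport_iff_eventuallyEq.mp fun h => hy.2 (hρ.subset h)
    have h2 : ψ + (θ + ρ) =ᶠ[𝓝 y] ψ + θ := by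
      filter_upwards [h1] with w hw
      simp [hw]
    rw [h2.fderiv_eq]
    exact hM _ (norm_add_fderiv_le (hψ.add hθlip) y)
  have hsub : ball x s ⊆ closedBall x r :=
    ball_subset_closedBall.trans (closedBall_subset_closedBall hsr.le)
  have hinteg := integrableOn_comp_fderiv hW hb A htot
    (measure_closedBall_lt_top (x := x) (r := r) (μ := volume)).ne
  have hvol : volume.real (closedBall x r \ ball x s) =
      (r ^ d - s ^ d) * volume.real (ball (0 : Vec d) 1) := by
    rw [measureReal_sdiff hsub measurableSet_ball
      measure_closedBall_lt_top.ne, volume_real_closedBall x hr,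
      volume_real_ball x hs, sub_mul]
  rw [← integral_inter_add_sdiff measurableSet_ball hinteg, inter_eq_self_of_subset_right hsub,
    volume_real_closedBall x hr]
  rw [hvol] at houter
  set v := volume.real (ball (0 : Vec d) 1) with hv
  have hvpos : 0 < v := volume_real_ball_pos
  have hsd : s ^ d = (1 - t) ^ d * r ^ d := by rw [hs_def, mul_pow]
  rw [hsd] at hinner houter
  rw [le_div_iff₀ (by positivity)] at ht
  set q := (1 - t) ^ d with hq
  have hq1 : q ≤ 1 := pow_le_one₀ (by linarith) (by linarith)
  have key : q * (z + ε / 2) + (1 - q) * M ≤ z + ε := by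
    have := mul_le_mul_of_nonneg_left (neg_abs_le z) (by linarith : 0 ≤ 1 - q)
    nlinarith
  calc _ ≤ r ^ d * v * (q * (z + ε / 2) + (1 - q) * M) := by linarith
    _ ≤ _ := by gcongr

theorem IsTest.add {U : Set (Vec d)} {φ ψ : Vec d → Vec d} (hφ : IsTest U φ) (hψ : IsTest U ψ) :
    IsTest U (φ + ψ) := by
  obtain ⟨K, hK⟩ := hφ.lipschitz
  obtain ⟨L, hL⟩ := hψ.lipschitz
  exact ⟨⟨K + L, hK.add hL⟩, hφ.compact.add hψ.compact,
    (tsupport_add φ ψ).trans (union_subset hφ.subset hψ.subset)⟩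

theorem IsTest.sum {ι : Type*} {U : Set (Vec d)} (F : Finset ι) {θ : ι → Vec d → Vec d}
    (h : ∀ i ∈ F, IsTest U (θ i)) : IsTest U (∑ i ∈ F, θ i) :=
  Finset.sum_induction θ (IsTest U) (fun _ _ => IsTest.add) (isTest_zero U) h

/-- A countable family of closed balls covering `U` almost everywhere has a finite subfamily
covering `U` up to small measure. -/
theorem exists_finset_measure_diff_lt {U t : Set (Vec d)} {r : Vec d → ℝ} (ht : t.Countable)
    (hU : volume U ≠ ⊤) (hcov : volume (U \ ⋃ x ∈ t, closedBall x (r x)) = 0)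
    {η : ℝ} (hη : 0 < η) :
    ∃ F : Finset t, volume.real (U \ ⋃ x ∈ F, closedBall x.1 (r x)) < η := by
  have : Countable t := ht
  set s : Finset t → Set (Vec d) := fun F => U \ ⋃ x ∈ F, closedBall x.1 (r x) with hs
  have hmeas : ∀ F : Finset t, MeasurableSet (⋃ x ∈ F, closedBall x.1 (r x)) := fun F =>
    F.measurableSet_biUnion fun _ _ => measurableSet_closedBall
  have hmono : Monotone fun F : Finset t => ⋃ x ∈ F, closedBall x.1 (r x) := fun F G hFG =>
    biUnion_subset_biUnion_left hFG
  have h1 := tendsto_measure_iUnion_atTop (μ := volume.restrict U) hmono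
  have h2 : volume.restrict U (⋃ F : Finset t, ⋃ x ∈ F, closedBall x.1 (r x)) = volume U := by
    rw [← iUnion_eq_iUnion_finset, iUnion_coe_set,
      Measure.restrict_apply (MeasurableSet.biUnion ht fun _ _ => measurableSet_closedBall),
      inter_comm, ← measure_inter_add_sdiff U
        (MeasurableSet.biUnion ht fun x _ => measurableSet_closedBall (x := x) (ε := r x)), hcov,
      add_zero]
  rw [h2] at h1
  have h3 := (ENNReal.tendsto_toReal hU).comp h1
  obtain ⟨F, hF⟩ := (h3.eventually_const_lt (sub_lt_self _ hη)).exists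
  refine ⟨F, ?_⟩
  have h4 := measureReal_inter_add_sdiff (μ := volume) (s := U) (hmeas F) hU
  simp only [Function.comp, Measure.restrict_apply (hmeas F)] at hF
  rw [inter_comm] at hF
  simp only [Measure.real] at h4 ⊢
  linarith

/-- Relaxation: if every value of `ζ` is approximately achieved by perturbations of constant
gradients, then the energy of any test map for `ζ` is approximately achieved by test maps for
`W`. -/
theorem exists_test_integral_le {W ζ : Lin d → ℝ} (hW : Measurable W) (hb : BddOnBdd W)
    (hζ : Measurable ζ) (hζb : BddOnBdd ζ) (H : HasTests W ζ) {U : Set (Vec d)} (hUo : IsOpen U)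
    (hUb : Bornology.IsBounded U) (A : Lin d) {ψ : Vec d → Vec d} (hψ : IsTest U ψ) {ε : ℝ}
    (hε : 0 < ε) :
    ∃ φ, IsTest U φ ∧
      ∫ x in U, W (A + fderiv ℝ φ x) ≤ (∫ x in U, ζ (A + fderiv ℝ ψ x)) + ε := by
  classical
  obtain ⟨L, hL⟩ := hψ.lipschitz
  obtain ⟨M₁, hM₁⟩ := hb (‖A‖ + L)
  obtain ⟨M₂, hM₂⟩ := hζb (‖A‖ + L)
  have hM₁0 : 0 ≤ M₁ := (abs_nonneg _).trans (hM₁ 0 (by rw [norm_zero]; positivity))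
  have hM₂0 : 0 ≤ M₂ := (abs_nonneg _).trans (hM₂ 0 (by rw [norm_zero]; positivity))
  have hUfin : volume U ≠ ⊤ := hUb.measure_lt_top.ne
  set v := volume.real U with hv
  set η := ε / (2 * v + M₁ + M₂ + 1) with hη_def
  have hv0 : 0 ≤ v := measureReal_nonneg
  have hη : 0 < η := by positivity
  set g : Vec d → ℝ := fun x => ζ (A + fderiv ℝ ψ x) with hg
  have hgloc : LocallyIntegrable g volume := (locallyIntegrable_iff).2 fun k hk =>
    integrableOn_comp_fderiv hζ hζb A hL hk.measure_lt_top.ne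
  have hleb := (Besicovitch.vitaliFamily (volume : Measure (Vec d))).ae_tendsto_average hgloc
  let f : Vec d → Set ℝ := fun x => {r | closedBall x r ⊆ U ∧
    volume.real (closedBall x r) * g x ≤
      (∫ y in closedBall x r, g y) + η * volume.real (closedBall x r) ∧
    ∃ θ, IsTest (ball x r) θ ∧ ∫ y in closedBall x r, W (A + fderiv ℝ (ψ + θ) y) ≤
      volume.real (closedBall x r) * (g x + η)}
  let S : Set (Vec d) := {x | x ∈ U ∧ ∀ᶠ r in 𝓝[>] 0, r ∈ f x}
  have hS : volume (U \ S) = 0 := by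
    have : ∀ᵐ x, x ∈ U → x ∈ S := by
      filter_upwards [hleb, hL.ae_differentiableAt] with x hx hxd hxU
      refine ⟨hxU, ?_⟩
      have e1 : ∀ᶠ r in 𝓝[>] (0 : ℝ), closedBall x r ⊆ U := by
        obtain ⟨δ, hδ, hδU⟩ := Metric.isOpen_iff.1 hUo x hxU
        filter_upwards [Ioo_mem_nhdsGT hδ] with r hr
        exact (closedBall_subset_ball hr.2).trans hδU
      have e2 : ∀ᶠ r in 𝓝[>] (0 : ℝ), g x - η < ⨍ y in closedBall x r, g y :=
        (hx.comp (Besicovitch.tendsto_filterAt volume x)).eventually_const_lt (sub_lt_self _ hη)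
      have e3 : ∀ᶠ r in 𝓝[>] (0 : ℝ), ∃ θ, IsTest (ball x r) θ ∧
          ∫ y in closedBall x r, W (A + fderiv ℝ (ψ + θ) y) ≤
            volume.real (closedBall x r) * (g x + η) := by
        obtain ⟨r₀, hr₀, h⟩ := exists_local_modification hW hb hL hxd (H (A + fderiv ℝ ψ x)) hη
        filter_upwards [Ioo_mem_nhdsGT hr₀] with r hr
        exact h r hr.1 hr.2
      filter_upwards [e1, e2, e3, self_mem_nhdsWithin] with r h1 h2 h3 h4
      refine ⟨h1, ?_, h3⟩
      rw [setAverage_eq, smul_eq_mul, ← div_eq_inv_mul, lt_div_iff₀] at h2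
      · linarith
      · rw [volume_real_closedBall x h4]
        exact mul_pos (pow_pos h4 _) volume_real_ball_pos
    rw [ae_iff] at this
    convert! this using 2
    ext x
    simp
  obtain ⟨t, r, htc, htS, htr, hcov, hdisj⟩ :=
    Besicovitch.exists_disjoint_closedBall_covering_ae volume f S
      (fun x hx δ hδ => (hx.2.and (Ioo_mem_nhdsGT hδ)).exists) (fun _ => 1) (fun _ _ => one_pos)
  have hcovU : volume (U \ ⋃ x ∈ t, closedBall x (r x)) = 0 :=
    measure_mono_null (fun x hx => by
      by_cases h : x ∈ S
      · exact Or.inr ⟨h, hx.2⟩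
      · exact Or.inl ⟨hx.1, h⟩) (measure_union_null hS hcov)
  obtain ⟨F, hF⟩ := exists_finset_measure_diff_lt htc hUfin hcovU hη
  choose θ hθ using fun x : t => (htr x x.2).1.2.2
  set B : t → Set (Vec d) := fun x => closedBall x.1 (r x) with hB
  set K := ⋃ x ∈ F, B x with hK
  have hBU : ∀ x, B x ⊆ U := fun x => (htr x x.2).1.1
  have hBm : ∀ x, MeasurableSet (B x) := fun x => measurableSet_closedBall
  have hKU : K ⊆ U := iUnion₂_subset fun x _ => hBU x
  have hKm : MeasurableSet K := F.measurableSet_biUnion fun x _ => hBm x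
  have hBd : Pairwise fun x y : t => Disjoint (B x) (B y) := fun x y hxy =>
    hdisj x.2 y.2 fun h => hxy (Subtype.ext h)
  have hθB : ∀ x, tsupport (θ x) ⊆ B x := fun x => (hθ x).1.subset.trans ball_subset_closedBall
  have hsumtest : IsTest U (∑ x ∈ F, θ x) :=
    IsTest.sum F fun x _ => (hθ x).1.mono (ball_subset_closedBall.trans (hBU x))
  refine ⟨ψ + ∑ x ∈ F, θ x, hψ.add hsumtest, ?_⟩
  obtain ⟨N, hN⟩ := (hψ.add hsumtest).lipschitz
  set φ := ψ + ∑ x ∈ F, θ x with hφ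
  have hzero : ∀ (y : Vec d) (P : t → Prop), (∀ x ∈ F, P x → y ∉ B x) →
      ∀ᶠ w in 𝓝 y, ∀ x ∈ F, P x → θ x w = 0 := by
    intro y P h
    rw [Filter.eventually_all_finset]
    intro x hx
    by_cases hP : P x
    · filter_upwards [notMem_tsupport_iff_eventuallyEq.mp fun h' => h x hx hP (hθB x h')]
        with w hw _ using hw
    · exact Eventually.of_forall fun w h' => absurd h' hP
  have hin : ∀ x ∈ F, ∀ y ∈ B x, fderiv ℝ φ y = fderiv ℝ (ψ + θ x) y := by
    intro x hx y hy
    refine Filter.EventuallyEq.fderiv_eq ?_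
    filter_upwards [hzero y (fun x' => x' ≠ x) fun x' _ hne hy' =>
      (Set.disjoint_left.1 (hBd hne) hy') hy] with w hw
    rw [hφ, Pi.add_apply, Pi.add_apply, Finset.sum_apply, Finset.sum_eq_single_of_mem x hx hw]
  have hout : ∀ y ∉ K, fderiv ℝ φ y = fderiv ℝ ψ y := by
    intro y hy
    refine Filter.EventuallyEq.fderiv_eq ?_
    filter_upwards [hzero y (fun _ => True) fun x hx _ hyx => hy (mem_biUnion hx hyx)] with w hw
    rw [hφ, Pi.add_apply, Finset.sum_apply, Finset.sum_eq_zero fun x hx => hw x hx trivial,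
      add_zero]
  have hintW := integrableOn_comp_fderiv hW hb A hN hUfin
  have hintg : IntegrableOn g U := integrableOn_comp_fderiv hζ hζb A hL hUfin
  have hfinD : volume (U \ K) < ⊤ := (measure_mono sdiff_subset).trans_lt hUfin.lt_top
  have hW1 : ∫ y in U \ K, W (A + fderiv ℝ φ y) ≤ M₁ * volume.real (U \ K) := by
    refine (Real.le_norm_self _).trans (norm_setIntegral_le_of_norm_le_const hfinD fun y hy => ?_)
    rw [hout y hy.2]
    exact hM₁ _ (norm_add_fderiv_le hL y)
  have hg1 : -(∫ y in U \ K, g y) ≤ M₂ * volume.real (U \ K) := by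
    have h := norm_setIntegral_le_of_norm_le_const (f := g) hfinD fun y _ =>
      hM₂ _ (norm_add_fderiv_le hL y)
    exact (neg_le_abs _).trans h
  have hterm : ∀ x ∈ F, ∫ y in B x, W (A + fderiv ℝ φ y) ≤
      (∫ y in B x, g y) + 2 * η * volume.real (B x) := by
    intro x hx
    rw [setIntegral_congr_fun (hBm x) fun y hy => by rw [hin x hx y hy]]
    have h1 := (hθ x).2
    have h2 := (htr x x.2).1.2.1
    linarith
  have hsplitW : ∫ y in U, W (A + fderiv ℝ φ y) =
      ∑ x ∈ F, (∫ y in B x, W (A + fderiv ℝ φ y)) + ∫ y in U \ K, W (A + fderiv ℝ φ y) := by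
    rw [← integral_inter_add_sdiff hKm hintW, inter_eq_self_of_subset_right hKU, hK,
      integral_biUnion_finset F (fun x _ => hBm x) (fun x _ y _ h => hBd h)
      fun x _ => hintW.mono_set (hBU x)]
  have hsplitg : ∫ y in U, g y = ∑ x ∈ F, (∫ y in B x, g y) + ∫ y in U \ K, g y := by
    rw [← integral_inter_add_sdiff hKm hintg, inter_eq_self_of_subset_right hKU, hK,
      integral_biUnion_finset F (fun x _ => hBm x) (fun x _ y _ h => hBd h)
      fun x _ => hintg.mono_set (hBU x)]
  have hvolsum : ∑ x ∈ F, volume.real (B x) ≤ v := by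
    rw [← measureReal_biUnion_finset (fun x _ y _ h => hBd h) (fun x _ => hBm x)
      fun x _ => ((measure_mono (hBU x)).trans_lt hUfin.lt_top).ne]
    exact measureReal_mono hKU hUfin
  have hsum := Finset.sum_le_sum hterm
  rw [Finset.sum_add_distrib, ← Finset.mul_sum] at hsum
  have hηε : η * (2 * v + M₁ + M₂ + 1) = ε := by rw [hη_def]; field_simp
  rw [hsplitW, hsplitg]
  nlinarith [mul_le_mul_of_nonneg_left hvolsum hη.le, mul_le_mul_of_nonneg_left hF.le hM₁0,
    mul_le_mul_of_nonneg_left hF.le hM₂0]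

theorem fderiv_eq_of_le_of_eq {f g : Vec d → ℝ} {x : Vec d} (hf : DifferentiableAt ℝ f x)
    (hg : DifferentiableAt ℝ g x) (hle : ∀ y, f y ≤ g y) (heq : f x = g x) :
    fderiv ℝ f x = fderiv ℝ g x := by
  have h : IsLocalMin (g - f) x := Eventually.of_forall fun y => by
    simp only [Pi.sub_apply]
    linarith [hle y]
  have hzero := h.fderiv_eq_zero
  rw [fderiv_sub hg hf, sub_eq_zero] at hzero
  exact hzero.symm

/-- Lipschitz functions whose gradient takes almost everywhere finitely many values. -/
def HasFiniteSlopes (f : Vec d → ℝ) : Prop :=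
  (∃ K, LipschitzWith K f) ∧
    ∃ S : Set (Vec d →L[ℝ] ℝ), S.Finite ∧ ∀ᵐ x, fderiv ℝ f x ∈ S

theorem HasFiniteSlopes.max {f g : Vec d → ℝ} (hf : HasFiniteSlopes f) (hg : HasFiniteSlopes g) :
    HasFiniteSlopes fun x => max (f x) (g x) := by
  obtain ⟨⟨K, hK⟩, S, hS, hfS⟩ := hf
  obtain ⟨⟨L, hL⟩, T, hT, hgT⟩ := hg
  refine ⟨⟨_, hK.max hL⟩, S ∪ T, hS.union hT, ?_⟩
  filter_upwards [hfS, hgT, hK.ae_differentiableAt, hL.ae_differentiableAt,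
    (hK.max hL).ae_differentiableAt] with x h1 h2 h3 h4 h5
  rcases le_total (g x) (f x) with h | h
  · rw [← fderiv_eq_of_le_of_eq h3 h5 (fun y => le_max_left _ _) (max_eq_left h).symm]
    exact Or.inl h1
  · rw [← fderiv_eq_of_le_of_eq h4 h5 (fun y => le_max_right _ _) (max_eq_right h).symm]
    exact Or.inr h2

theorem HasFiniteSlopes.neg {f : Vec d → ℝ} (hf : HasFiniteSlopes f) :
    HasFiniteSlopes fun x => -f x := by
  obtain ⟨⟨K, hK⟩, S, hS, hfS⟩ := hf
  refine ⟨⟨K, hK.neg⟩, (fun D => -D) '' S, hS.image _, ?_⟩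
  filter_upwards [hfS] with x hx
  exact ⟨_, hx, (fderiv_fun_neg).symm⟩

theorem HasFiniteSlopes.min {f g : Vec d → ℝ} (hf : HasFiniteSlopes f) (hg : HasFiniteSlopes g) :
    HasFiniteSlopes fun x => min (f x) (g x) := by
  simpa [max_neg_neg] using (hf.neg.max hg.neg).neg

theorem hasFiniteSlopes_linear (D : Vec d →L[ℝ] ℝ) : HasFiniteSlopes D :=
  ⟨⟨_, D.lipschitz⟩, {D}, finite_singleton D, ae_of_all _ fun _ => D.fderiv⟩

theorem hasFiniteSlopes_const (a : ℝ) : HasFiniteSlopes fun _ : Vec d => a :=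
  ⟨⟨0, LipschitzWith.const a⟩, {0}, finite_singleton 0, ae_of_all _ fun _ => by simp⟩

theorem exists_norm_eq_apply (hd : 1 ≤ d) (y : Vec d) : ∃ i, ‖y‖ = |y i| := by
  have : Nonempty (Fin d) := ⟨⟨0, hd⟩⟩
  obtain ⟨i, -, hi⟩ := Finset.exists_max_image Finset.univ (fun i => |y i|) Finset.univ_nonempty
  exact ⟨i, le_antisymm ((pi_norm_le_iff_of_nonneg (abs_nonneg _)).2 fun j => hi j (by simp))
    (norm_le_pi_norm y i)⟩

theorem hasFiniteSlopes_norm (hd : 1 ≤ d) (c : NNReal) :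
    HasFiniteSlopes fun y : Vec d => (c : ℝ) * ‖y‖ := by
  have hL : LipschitzWith c fun y : Vec d => (c : ℝ) * ‖y‖ :=
    LipschitzWith.of_dist_le_mul fun y z => by
      rw [Real.dist_eq, ← mul_sub, abs_mul, NNReal.abs_eq, dist_eq_norm]
      gcongr
      exact abs_norm_sub_norm_le y z
  let D : Fin d × Bool → Vec d →L[ℝ] ℝ := fun p =>
    ((c : ℝ) * if p.2 then 1 else -1) • ContinuousLinearMap.proj p.1
  refine ⟨⟨c, hL⟩, range D, finite_range D, ?_⟩
  filter_upwards [hL.ae_differentiableAt] with y hy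
  have key : ∃ p, D p y = c * ‖y‖ := by
    obtain ⟨i, hi⟩ := exists_norm_eq_apply hd y
    rcases abs_choice (y i) with h | h
    · exact ⟨(i, true), by simp [D, hi, h]⟩
    · exact ⟨(i, false), by simp [D, hi, h]⟩
  obtain ⟨p, hp⟩ := key
  refine ⟨p, ?_⟩
  rw [← fderiv_eq_of_le_of_eq (D p).differentiableAt hy (fun z => ?_) hp, (D p).fderiv]
  have h1 := abs_le.1 (norm_le_pi_norm z p.1)
  rcases p with ⟨i, _ | _⟩
  · simp only [D, Bool.false_eq_true, if_false, _root_.smul_apply,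
      ContinuousLinearMap.proj_apply, smul_eq_mul, mul_assoc]
    gcongr
    linarith
  · simp only [D, if_true, _root_.smul_apply,
      ContinuousLinearMap.proj_apply, smul_eq_mul, mul_assoc]
    gcongr
    linarith

theorem HasFiniteSlopes.const_add {f : Vec d → ℝ} (hf : HasFiniteSlopes f) (a : ℝ) :
    HasFiniteSlopes fun x => a + f x := by
  obtain ⟨⟨K, hK⟩, S, hS, hfS⟩ := hf
  refine ⟨⟨0 + K, (LipschitzWith.const a).add hK⟩, S, hS, ?_⟩
  filter_upwards [hfS] with x hx
  rwa [fderiv_const_add]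

theorem hasFiniteSlopes_tent (hd : 1 ≤ d) (c : NNReal) (ρ : ℝ) :
    HasFiniteSlopes (tent (0 : Vec d) c ρ) := by
  have h := (hasFiniteSlopes_const 0).max
    (((hasFiniteSlopes_norm hd c).neg).const_add ((c : ℝ) * ρ))
  convert! h using 2 with y
  rw [tent, sub_zero, mul_sub, sub_eq_add_neg]

theorem exists_finite_fderiv_mem {θ : Vec d → Vec d} (h : ∀ i, HasFiniteSlopes fun x => θ x i) :
    ∃ S : Set (Lin d), S.Finite ∧ ∀ᵐ x, fderiv ℝ θ x ∈ S := by
  choose h₁ S hS hθS using h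
  choose K hK using h₁
  let P : Lin d → Fin d → (Vec d →L[ℝ] ℝ) := fun D i => (ContinuousLinearMap.proj i).comp D
  have hP : Function.Injective P := fun D D' hDD => by
    ext x i
    exact congrArg (fun Q : Vec d →L[ℝ] ℝ => Q x) (congrFun hDD i)
  refine ⟨P ⁻¹' Set.univ.pi S, (Finite.pi fun i => hS i).preimage hP.injOn, ?_⟩
  filter_upwards [ae_all_iff.2 hθS, ae_all_iff.2 fun i => (hK i).ae_differentiableAt]
    with x hx hdx i _
  have : HasFDerivAt θ (ContinuousLinearMap.pi fun i => fderiv ℝ (fun x => θ x i) x) x :=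
    hasFDerivAt_pi.2 fun i => (hdx i).hasFDerivAt
  rw [this.fderiv]
  exact hx i

theorem integrableOn_comp_of_ae_mem_finite {f : Vec d → Lin d} (hf : Measurable f)
    {S : Set (Lin d)} (hS : S.Finite) (hfS : ∀ᵐ x, f x ∈ S) (G : Lin d → ℝ) {s : Set (Vec d)}
    (hs : volume s ≠ ⊤) : IntegrableOn (fun x => G (f x)) s := by
  classical
  have h1 : IntegrableOn (fun x => ∑ D ∈ hS.toFinset, (f ⁻¹' {D}).indicator (fun _ => G D) x) s :=
    integrable_finsetSum _ fun D _ =>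
      (integrableOn_const hs).indicator (hf (measurableSet_singleton D))
  refine Integrable.congr h1 (ae_restrict_of_ae ?_)
  filter_upwards [hfS] with x hx
  have h2 : ∀ D ∈ hS.toFinset, D ≠ f x → (f ⁻¹' {D}).indicator (fun _ => G D) x = 0 :=
    fun D _ hD => indicator_of_notMem (fun h : f x = D => hD h.symm) _
  rw [Finset.sum_eq_single_of_mem (f x) (hS.mem_toFinset.2 hx) h2]
  exact indicator_of_mem (s := f ⁻¹' {f x}) rfl _

/-- A test map turning the constant gradient `A` into `B` on most of the unit cube, with gradients
taking finitely many values. -/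
theorem exists_test_step (hd : 1 ≤ d) (A B : Lin d) {t : ℝ} (ht0 : 0 < t) (ht1 : t < 1) :
    ∃ ψ, IsTest (ball 0 1) ψ ∧ ∀ (G : Lin d → ℝ) (C : ℝ),
      (∀ X, ‖X - A‖ ≤ 2 * ‖B - A‖ / t → G X ≤ C) →
        IntegrableOn (fun x => G (A + fderiv ℝ ψ x)) (ball 0 1) ∧
        ∫ x in ball 0 1, G (A + fderiv ℝ ψ x) ≤
          volume.real (ball (0 : Vec d) 1) * ((1 - t) ^ d * G B + (1 - (1 - t) ^ d) * C) := by
  set c : NNReal := ⟨2 * ‖B - A‖ / t, by positivity⟩ with hc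
  have hc' : (c : ℝ) = 2 * ‖B - A‖ / t := rfl
  have hsmall : ∀ y ∈ ball (0 : Vec d) ((1 - t) * 1), ‖(B - A) y‖ ≤ c * (t / 2 * 1) := by
    intro y hy
    rw [mem_ball_zero_iff] at hy
    have h1 : (c : ℝ) * (t / 2 * 1) = ‖B - A‖ * 1 := by rw [hc']; field_simp
    rw [h1]
    exact (B - A).le_opNorm_of_le (by linarith)
  obtain ⟨hsupp, heq⟩ := clamp_tent_spec 0 one_pos ht0 c hsmall
  rw [mul_one, mul_one] at *
  set ψ := clamp (B - A) (tent 0 c (1 - t / 2)) with hψ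
  have hlip : LipschitzWith c ψ := by
    have h := lipschitzWith_clamp (B - A).lipschitz (lipschitzWith_tent (0 : Vec d) c (1 - t / 2))
    refine h.weaken (max_le ?_ le_rfl)
    rw [← NNReal.coe_le_coe, hc', coe_nnnorm, le_div_iff₀ ht0]
    nlinarith [norm_nonneg (B - A)]
  obtain ⟨S, hS, hψS⟩ := exists_finite_fderiv_mem (θ := ψ) fun i =>
    (hasFiniteSlopes_tent hd c (1 - t / 2)).neg.max ((hasFiniteSlopes_tent hd c (1 - t / 2)).min
      (hasFiniteSlopes_linear ((ContinuousLinearMap.proj i).comp (B - A))))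
  refine ⟨ψ, .of_isBounded isBounded_ball hlip hsupp, fun G C hGC => ?_⟩
  have hinteg : IntegrableOn (fun x => G (A + fderiv ℝ ψ x)) (ball 0 1) :=
    integrableOn_comp_of_ae_mem_finite (measurable_fderiv ℝ ψ) hS hψS (fun D => G (A + D))
      measure_ball_lt_top.ne
  refine ⟨hinteg, ?_⟩
  have hsub : ball (0 : Vec d) (1 - t) ⊆ ball 0 1 := ball_subset_ball (by linarith)
  have hvin : volume.real (ball (0 : Vec d) (1 - t)) =
      (1 - t) ^ d * volume.real (ball (0 : Vec d) 1) := volume_real_ball 0 (by linarith)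
  have hin : ∫ x in ball 0 (1 - t), G (A + fderiv ℝ ψ x) =
      volume.real (ball (0 : Vec d) (1 - t)) * G B := by
    have h : ∀ x ∈ ball (0 : Vec d) (1 - t), G (A + fderiv ℝ ψ x) = G B := by
      intro x hx
      have h1 : ψ =ᶠ[𝓝 x] ⇑(B - A) :=
        Filter.eventually_of_mem (isOpen_ball.mem_nhds hx) heq
      have h2 : HasFDerivAt ψ (B - A) x := (B - A).hasFDerivAt.congr_of_eventuallyEq h1
      rw [h2.fderiv, add_sub_cancel]
    rw [setIntegral_congr_fun measurableSet_ball h, setIntegral_const, smul_eq_mul]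
  have hout : ∫ x in ball 0 1 \ ball 0 (1 - t), G (A + fderiv ℝ ψ x) ≤
      volume.real (ball (0 : Vec d) 1 \ ball 0 (1 - t)) * C := by
    have hfin : volume (ball (0 : Vec d) 1 \ ball 0 (1 - t)) ≠ ⊤ :=
      ((measure_mono sdiff_subset).trans_lt measure_ball_lt_top).ne
    calc _ ≤ ∫ _ in ball (0 : Vec d) 1 \ ball 0 (1 - t), C := by
          refine setIntegral_mono (hinteg.mono_set sdiff_subset) (integrableOn_const hfin)
            fun x => hGC _ ?_
          rw [add_sub_cancel_left]
          exact norm_fderiv_le_of_lipschitz ℝ hlip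
      _ = _ := by rw [setIntegral_const, smul_eq_mul]
  rw [measureReal_sdiff hsub measurableSet_ball measure_ball_lt_top.ne, hvin] at hout
  rw [hvin] at hin
  rw [← integral_inter_add_sdiff measurableSet_ball hinteg, inter_eq_self_of_subset_right hsub, hin]
  linarith

/-- The inequality obtained by testing with `exists_test_step` forces continuity. -/
theorem continuous_of_step {F W : Lin d → ℝ} (hb : BddOnBdd W)
    (h : ∀ A B : Lin d, ∀ t C : ℝ, 0 < t → t < 1 →
      (∀ X, ‖X - A‖ ≤ 2 * ‖B - A‖ / t → W X ≤ C) →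
        F A ≤ (1 - t) ^ d * F B + (1 - (1 - t) ^ d) * C) : Continuous F := by
  rw [Metric.continuous_iff]
  intro A ε hε
  obtain ⟨C, hC⟩ := hb (‖A‖ + 2)
  have hC0 : 0 ≤ C := (abs_nonneg _).trans (hC 0 (by rw [norm_zero]; positivity))
  obtain ⟨t, ht0, ht1, ht⟩ := exists_one_sub_pow_le d
    (η := min (1 / 2) (ε / (2 * (C + |F A| + 1)))) (by positivity)
  obtain ⟨hq1, hq2⟩ := le_min_iff.1 ht
  refine ⟨t / 2, by positivity, fun B hB => ?_⟩
  rw [dist_eq_norm] at hB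
  have hBA : 2 * ‖B - A‖ / t ≤ 1 := by
    rw [div_le_one ht0]; linarith
  have h1 := h A B t C ht0 ht1 fun X hX => (le_abs_self _).trans <| hC X <| by
    have := norm_le_norm_add_norm_sub' X A
    linarith
  have h2 := h B A t C ht0 ht1 fun X hX => (le_abs_self _).trans <| hC X <| by
    have h3 := norm_le_norm_add_norm_sub' X B
    have h4 := norm_le_norm_add_norm_sub' B A
    rw [norm_sub_rev A B] at hX
    linarith
  rw [le_div_iff₀ (by positivity)] at hq2
  set q := (1 - t) ^ d with hq
  have hq3 : q ≤ 1 := pow_le_one₀ (by linarith) (by linarith)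
  have h5 := mul_le_mul_of_nonneg_left (neg_abs_le (F A)) (by linarith : 0 ≤ 1 - q)
  have hqpos : 0 < 1 - q ∨ 1 - q = 0 := (by linarith : 0 ≤ 1 - q).lt_or_eq.imp_right Eq.symm
  rw [Real.dist_eq, abs_lt]
  rcases hqpos with hqpos | hq0
  · constructor <;> nlinarith
  · have : q = 1 := by linarith
    rw [this] at h1 h2
    constructor <;> linarith

/-- The averages of `W` over perturbations of the constant gradient `A` on the unit cube. -/
def averages (W : Lin d → ℝ) (A : Lin d) : Set ℝ :=
  {y | ∃ φ, IsTest (ball 0 1) φ ∧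
    y = (volume.real (ball (0 : Vec d) 1))⁻¹ * ∫ x in ball 0 1, W (A + fderiv ℝ φ x)}

/-- The relaxed energy density. -/
def relax (W : Lin d → ℝ) (A : Lin d) : ℝ := sInf (averages W A)

theorem self_mem_averages (W : Lin d → ℝ) (A : Lin d) : W A ∈ averages W A := by
  refine ⟨0, isTest_zero _, ?_⟩
  have h : ∀ x : Vec d, W (A + fderiv ℝ (0 : Vec d → Vec d) x) = W A := fun x => by simp
  simp only [h, setIntegral_const, smul_eq_mul]
  rw [inv_mul_cancel_left₀ volume_real_ball_pos.ne']

theorem exists_test_of_mem_averages {W : Lin d → ℝ} {B : Lin d} {y z : ℝ}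
    (hy : y ∈ averages W B) (hyz : y ≤ z) :
    ∃ φ, IsTest (ball 0 1) φ ∧
      ∫ x in ball 0 1, W (B + fderiv ℝ φ x) ≤ volume.real (ball (0 : Vec d) 1) * z := by
  obtain ⟨φ, hφ, rfl⟩ := hy
  exact ⟨φ, hφ, by rwa [inv_mul_le_iff₀ volume_real_ball_pos] at hyz⟩

theorem mul_volume_le_of_forall_averages {W : Lin d → ℝ} {A : Lin d} {m : ℝ}
    (hm : ∀ y ∈ averages W A, m ≤ y) {φ : Vec d → Vec d} (hφ : IsTest (ball 0 1) φ) :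
    volume.real (ball (0 : Vec d) 1) * m ≤ ∫ x in ball 0 1, W (A + fderiv ℝ φ x) := by
  have := hm _ ⟨φ, hφ, rfl⟩
  rwa [le_inv_mul_iff₀ volume_real_ball_pos] at this

/-- Lower bounds for the averages at `A` are controlled by approximate averages at `B`. -/
theorem le_step_of_averages (hd : 1 ≤ d) {W : Lin d → ℝ} (hW : Measurable W) (hb : BddOnBdd W)
    {A B : Lin d} {m z t C : ℝ} (hm : ∀ y ∈ averages W A, m ≤ y)
    (hz : ∀ ε > 0, ∃ y ∈ averages W B, y ≤ z + ε) (hzW : z ≤ W B) (ht0 : 0 < t) (ht1 : t < 1)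
    (hC : ∀ X, ‖X - A‖ ≤ 2 * ‖B - A‖ / t → W X ≤ C) :
    m ≤ (1 - t) ^ d * z + (1 - (1 - t) ^ d) * C := by
  classical
  let ζ : Lin d → ℝ := fun X => if X = B then z else W X
  have hζB : ζ B = z := if_pos rfl
  have hζW : ∀ X, ζ X ≤ W X := fun X => by
    by_cases h : X = B
    · rw [h, hζB]; exact hzW
    · simp [ζ, h]
  have hζm : Measurable ζ := Measurable.ite (measurableSet_singleton B) measurable_const hW
  have hζb : BddOnBdd ζ := fun R => by
    obtain ⟨M, hM⟩ := hb R
    refine ⟨max |z| M, fun X hX => ?_⟩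
    by_cases h : X = B
    · rw [h, hζB]; exact le_max_left _ _
    · simp only [ζ, h, if_false]; exact (hM X hX).trans (le_max_right _ _)
  have H : HasTests W ζ := fun X ε hε => by
    by_cases h : X = B
    · obtain ⟨y, hy, hyz⟩ := hz ε hε
      rw [h, hζB]
      exact exists_test_of_mem_averages hy hyz
    · simp only [ζ, h, if_false]
      exact exists_test_of_mem_averages (self_mem_averages W X) (by linarith)
  obtain ⟨ψ, hψ, hstep⟩ := exists_test_step hd A B ht0 ht1
  have h1 := (hstep ζ C fun X hX => (hζW X).trans (hC X hX)).2
  rw [hζB] at h1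
  refine le_of_mul_le_mul_left (le_of_forall_pos_le_add fun ε hε => ?_)
    (volume_real_ball_pos (d := d))
  obtain ⟨φ, hφ, hφi⟩ := exists_test_integral_le hW hb hζm hζb H isOpen_ball isBounded_ball A hψ hε
  have h2 := mul_volume_le_of_forall_averages hm hφ
  linarith

theorem bddBelow_averages (hd : 1 ≤ d) {W : Lin d → ℝ} (hW : Measurable W) (hb : BddOnBdd W)
    {A : Lin d} (hA : BddBelow (averages W A)) (B : Lin d) : BddBelow (averages W B) := by
  obtain ⟨m, hm⟩ := hA
  obtain ⟨C, hC⟩ := hb (‖A‖ + 2 * ‖B - A‖ / (1 / 2))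
  have hq : (0 : ℝ) < (1 - 1 / 2) ^ d := by positivity
  refine ⟨(m - (1 - (1 - 1 / 2) ^ d) * C) / (1 - 1 / 2) ^ d, fun y hy => ?_⟩
  have hmin : min y (W B) ∈ averages W B := by
    rcases min_choice y (W B) with h | h <;> rw [h]
    exacts [hy, self_mem_averages W B]
  have h := le_step_of_averages hd hW hb (t := 1 / 2) (C := C) (fun y hy => hm hy)
    (fun ε hε => ⟨_, hmin, by linarith⟩) (min_le_right _ _) (by norm_num) (by norm_num)
    fun X hX => (le_abs_self _).trans (hC X (by
      have := norm_le_norm_add_norm_sub' X A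
      linarith))
  rw [div_le_iff₀ hq]
  nlinarith [mul_le_mul_of_nonneg_left (min_le_left y (W B)) hq.le]

theorem Continuous.bddOnBdd {F : Lin d → ℝ} (hF : Continuous F) : BddOnBdd F := by
  intro R
  obtain ⟨C, hC⟩ := (isCompact_closedBall (0 : Lin d) R).exists_bound_of_continuousOn hF.continuousOn
  exact ⟨C, fun G hG => hC G (by simpa using hG)⟩

section Relax

variable {W : Lin d → ℝ}

theorem relax_le (hbdd : ∀ A, BddBelow (averages W A)) (A : Lin d) : relax W A ≤ W A :=
  csInf_le (hbdd A) (self_mem_averages W A)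

theorem exists_averages_le_relax (A : Lin d) {ε : ℝ} (hε : 0 < ε) :
    ∃ y ∈ averages W A, y ≤ relax W A + ε := by
  obtain ⟨y, hy, h⟩ := exists_lt_of_csInf_lt ⟨_, self_mem_averages W A⟩
    (lt_add_of_pos_right (sInf (averages W A)) hε)
  exact ⟨y, hy, h.le⟩

theorem hasTests_relax : HasTests W (relax W) := fun B _ hε => by
  obtain ⟨y, hy, h⟩ := exists_averages_le_relax (W := W) B hε
  exact exists_test_of_mem_averages hy h

theorem continuous_relax (hd : 1 ≤ d) (hW : Measurable W) (hb : BddOnBdd W)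
    (hbdd : ∀ A, BddBelow (averages W A)) : Continuous (relax W) :=
  continuous_of_step hb fun A B _ _ ht0 ht1 hC =>
    le_step_of_averages hd hW hb (fun _ hy => csInf_le (hbdd A) hy)
      (fun _ hε => exists_averages_le_relax B hε) (relax_le hbdd B) ht0 ht1 hC

theorem relax_mul_volume_le (hd : 1 ≤ d) (hW : Measurable W) (hb : BddOnBdd W)
    (hbdd : ∀ A, BddBelow (averages W A)) (A : Lin d) {ψ : Vec d → Vec d}
    (hψ : IsTest (ball 0 1) ψ) :
    volume.real (ball (0 : Vec d) 1) * relax W A ≤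
      ∫ x in ball 0 1, relax W (A + fderiv ℝ ψ x) := by
  have hcont := continuous_relax hd hW hb hbdd
  refine le_of_forall_pos_le_add fun ε hε => ?_
  obtain ⟨φ, hφ, hφi⟩ := exists_test_integral_le hW hb hcont.measurable
    (Continuous.bddOnBdd hcont) hasTests_relax isOpen_ball isBounded_ball A hψ hε
  exact (mul_volume_le_of_forall_averages (fun _ hy => csInf_le (hbdd A) hy) hφ).trans hφi

end Relax

/-- Quasiconvexity on the unit cube implies quasiconvexity on bounded open sets. -/
theorem mul_volume_le_setIntegral {F : Lin d → ℝ} (hF : Continuous F)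
    (hqc : ∀ A ψ, IsTest (ball 0 1) ψ →
      volume.real (ball (0 : Vec d) 1) * F A ≤ ∫ x in ball 0 1, F (A + fderiv ℝ ψ x))
    {U : Set (Vec d)} (hUo : IsOpen U) (hUb : Bornology.IsBounded U) (A : Lin d)
    {ψ : Vec d → Vec d} (hψ : IsTest U ψ) :
    F A * volume.real U ≤ ∫ x in U, F (A + fderiv ℝ ψ x) := by
  obtain ⟨R, hR, hUR⟩ := hUb.subset_ball_lt 0 0
  obtain ⟨L, hL⟩ := hψ.lipschitz
  have hRi : 0 < R⁻¹ := inv_pos.2 hR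
  have htest : IsTest (ball 0 1) (rescale 0 R⁻¹ ψ) := by
    refine .of_isBounded isBounded_ball (lipschitzWith_rescale hL 0 hRi) fun y hy => ?_
    have h := hUR (hψ.subset (tsupport_rescale_subset 0 R⁻¹ ψ hy))
    rw [mem_ball_zero_iff] at h
    simp only [sub_zero, inv_inv, norm_smul, Real.norm_of_nonneg hR.le] at h
    rw [mem_ball_zero_iff]
    nlinarith
  have hscale := setIntegral_ball_rescale
    (fun w => F (A + fderiv ℝ (rescale 0 R⁻¹ ψ) w)) 0 hR
  simp only [fderiv_rescale 0 hRi, sub_zero, inv_inv, smul_inv_smul₀ hR.ne'] at hscale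
  have h1 := hqc A _ htest
  simp only [fderiv_rescale 0 hRi, sub_zero, inv_inv] at h1
  have h2 : volume.real (ball (0 : Vec d) R) * F A ≤
      ∫ x in ball 0 R, F (A + fderiv ℝ ψ x) := by
    rw [hscale, volume_real_ball 0 hR, mul_assoc]
    gcongr
  have hinteg := integrableOn_comp_fderiv hF.measurable (Continuous.bddOnBdd hF) A hL
    (measure_ball_lt_top (x := (0 : Vec d)) (r := R) (μ := volume)).ne
  have hout : ∫ x in ball 0 R \ U, F (A + fderiv ℝ ψ x) =
      (volume.real (ball (0 : Vec d) R) - volume.real U) * F A := by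
    have h : ∀ x ∈ ball 0 R \ U, F (A + fderiv ℝ ψ x) = F A := fun x hx => by
      rw [fderiv_eq_zero_of_notMem_tsupport fun h => hx.2 (hψ.subset h), add_zero]
    rw [setIntegral_congr_fun (measurableSet_ball.diff hUo.measurableSet) h, setIntegral_const,
      smul_eq_mul, measureReal_sdiff hUR hUo.measurableSet measure_ball_lt_top.ne]
  rw [← integral_inter_add_sdiff hUo.measurableSet hinteg, inter_eq_self_of_subset_right hUR,
    hout] at h2
  linarith

/-- Quasiconvex functions below a locally bounded function are continuous; no measurability is
needed. -/
theorem continuous_of_quasiconvex (hd : 1 ≤ d) {F W : Lin d → ℝ} (hb : BddOnBdd W)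
    (hFW : ∀ A, F A ≤ W A)
    (hqc : ∀ A ψ, IsTest (ball 0 1) ψ →
      volume.real (ball (0 : Vec d) 1) * F A ≤ ∫ x in ball 0 1, F (A + fderiv ℝ ψ x)) :
    Continuous F :=
  continuous_of_step hb fun A B t C ht0 ht1 hC => by
    obtain ⟨ψ, hψ, h⟩ := exists_test_step hd A B ht0 ht1
    exact le_of_mul_le_mul_left
      ((hqc A ψ hψ).trans (h F C fun X hX => (hFW X).trans (hC X hX)).2) volume_real_ball_pos

theorem exists_average_le {W ζ : Lin d → ℝ} (hW : Measurable W) (hb : BddOnBdd W)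
    (hζ : Measurable ζ) (hζb : BddOnBdd ζ) (H : HasTests W ζ) {U : Set (Vec d)} (hUo : IsOpen U)
    (hUb : Bornology.IsBounded U) (hUne : U.Nonempty) {A : Lin d} {c : ℝ} (hc : ζ A < c) :
    ∃ φ, IsTest U φ ∧ 1 / volume.real U * ∫ x in U, W (A + fderiv ℝ φ x) ≤ c := by
  have hv : 0 < volume.real U :=
    ENNReal.toReal_pos (hUo.measure_pos volume hUne).ne' hUb.measure_lt_top.ne
  obtain ⟨φ, hφ, h⟩ := exists_test_integral_le hW hb hζ hζb H hUo hUb A (isTest_zero U)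
    (mul_pos hv (sub_pos.2 hc))
  refine ⟨φ, hφ, ?_⟩
  have h0 : ∀ x : Vec d, ζ (A + fderiv ℝ (0 : Vec d → Vec d) x) = ζ A := fun x => by simp
  simp only [h0, setIntegral_const, smul_eq_mul] at h
  rw [one_div, inv_mul_le_iff₀ hv]
  linarith

/-- The symmetric part of a gradient. -/
def strain (G : Lin d) : SymMat d := symPt (Matrix.of fun i j => G (Pi.single j 1) i)

/-- The linear map with a given symmetric matrix. -/
def symLin (E : SymMat d) : Lin d := LinearMap.toContinuousLinearMap (Matrix.toLin' E.1)

theorem strain_add (G D : Lin d) :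
    strain (G + D) = ⟨(strain G).1 + symPart (Matrix.of fun i j => D (Pi.single j 1) i),
      (strain G).2.add (symPart_isSymm _)⟩ := by
  apply Subtype.ext
  ext i j
  simp [strain, symPt, symPart]
  ring

theorem strain_symLin (E : SymMat d) : strain (symLin E) = E := by
  apply Subtype.ext
  ext i j
  have h : E.1 j i = E.1 i j := E.2.apply i j
  simp [strain, symPt, symPart, symLin, h]
  ring

theorem strain_symLin_strain_add (G D : Lin d) :
    strain (symLin (strain G) + D) = strain (G + D) := by
  rw [strain_add, strain_add]
  apply Subtype.ext
  simp only [strain_symLin]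

theorem continuous_strain : Continuous (strain : Lin d → SymMat d) := by
  refine Continuous.subtype_mk (continuous_matrix fun i j => ?_) _
  simp only [symPart, Matrix.smul_apply, Matrix.add_apply, Matrix.transpose_apply,
    Matrix.of_apply, smul_eq_mul]
  fun_prop

theorem continuous_frob : Continuous (frob : Mat d → ℝ) :=
  Real.continuous_sqrt.comp (continuous_finsetSum _ fun i _ => continuous_finsetSum _ fun j _ =>
    (continuous_id.matrix_elem i j).pow 2)

theorem frob_zero : frob (0 : Mat d) = 0 := by
  simp [frob]

/-- A function on `Lin d` that is bounded near every point is bounded on bounded sets. -/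
theorem bddOnBdd_of_eventually {F : Lin d → ℝ} (hF : ∀ A, ∃ C, ∀ᶠ G in 𝓝 A, |F G| ≤ C) :
    BddOnBdd F := by
  intro R
  have key : ∃ C, ∀ G ∈ closedBall (0 : Lin d) R, |F G| ≤ C := by
    refine (isCompact_closedBall (0 : Lin d) R).induction_on
      (p := fun s => ∃ C, ∀ G ∈ s, |F G| ≤ C) ⟨0, by simp⟩ ?_ ?_ ?_
    · rintro s t hst ⟨C, hC⟩
      exact ⟨C, fun G hG => hC G (hst hG)⟩
    · rintro s t ⟨C, hC⟩ ⟨C', hC'⟩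
      exact ⟨max C C', fun G hG => hG.elim (fun h => (hC G h).trans (le_max_left _ _))
        fun h => (hC' G h).trans (le_max_right _ _)⟩
    · intro A _
      obtain ⟨C, hC⟩ := hF A
      exact ⟨_, mem_nhdsWithin_of_mem_nhds hC, C, fun G hG => hG⟩
  obtain ⟨C, hC⟩ := key
  exact ⟨C, fun G hG => hC G (by simpa using hG)⟩

theorem bddOnBdd_comp_strain {V : SymMat d → ℝ}
    (hV : ∀ A : SymMat d, ∃ r > (0 : ℝ), ∃ C : ℝ,
      ∀ B : SymMat d, frob (B.1 - A.1) ≤ r → |V B| ≤ C) :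
    BddOnBdd fun G : Lin d => V (strain G) := by
  refine bddOnBdd_of_eventually fun G₀ => ?_
  obtain ⟨r, hr, C, hC⟩ := hV (strain G₀)
  have hcont : Continuous fun G : Lin d => frob ((strain G).1 - (strain G₀).1) :=
    continuous_frob.comp ((continuous_subtype_val.comp continuous_strain).sub continuous_const)
  have h0 : frob ((strain G₀).1 - (strain G₀).1) < r := by rwa [sub_self, frob_zero]
  refine ⟨C, ?_⟩
  filter_upwards [hcont.continuousAt.eventually_lt_const h0] with G hG
  exact hC _ hG.le

theorem relax_symLin_strain (V : SymMat d → ℝ) (G : Lin d) :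
    relax (fun G => V (strain G)) (symLin (strain G)) = relax (fun G => V (strain G)) G := by
  simp only [relax, averages, strain_symLin_strain_add]

end StrainEnvelope

open StrainEnvelope

/-- for `V` locally bounded and Borel measurable on the symmetric matrices
and `U ⊆ ℝ^d` a (nonempty) bounded open set whose boundary is Lebesgue null, for every
symmetric `E`, `V^{qce}(E) = inf_φ (1/|U|) ∫_U V(E + e(φ)(x)) dx`, the infimum running over
all Lipschitz `φ : ℝ^d → ℝ^d` with compact support contained in `U`. -/
theorem qceEnvelope_eq_inf (d : ℕ) (hd : 1 ≤ d)
    (V : SymMat d → ℝ) (hVmeas : Measurable V)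
    (hVloc : ∀ A : SymMat d, ∃ r > (0 : ℝ), ∃ C : ℝ,
      ∀ B : SymMat d, frob (B.1 - A.1) ≤ r → |V B| ≤ C)
    (U : Set (Fin d → ℝ)) (hUo : IsOpen U) (hUb : Bornology.IsBounded U)
    (hUne : U.Nonempty) (hUbd : volume (frontier U) = 0) :
    ∀ E : SymMat d,
      qceEnvelope V E =
        sInf {y : EReal | ∃ φ : (Fin d → ℝ) → (Fin d → ℝ),
          (∃ L : NNReal, LipschitzWith L φ) ∧ HasCompactSupport φ ∧ tsupport φ ⊆ U ∧
          y = ((1 / (volume U).toReal *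
            ∫ x in U, V ⟨E.1 + symPart (Dmat φ x), E.2.add (symPart_isSymm _)⟩ : ℝ) : EReal)} := by
  intro E
  set W : Lin d → ℝ := fun G => V (strain G) with hW_def
  have hW : Measurable W := hVmeas.comp continuous_strain.measurable
  have hb : BddOnBdd W := bddOnBdd_comp_strain hVloc
  have hv : 0 < volume.real U :=
    ENNReal.toReal_pos (hUo.measure_pos volume hUne).ne' hUb.measure_lt_top.ne
  have hVW : ∀ φ : Vec d → Vec d,
      ∫ x in U, V ⟨E.1 + symPart (Dmat φ x), E.2.add (symPart_isSymm _)⟩ =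
        ∫ x in U, W (symLin E + fderiv ℝ φ x) := fun φ => by
    simp only [hW_def, strain_add, strain_symLin]
    rfl
  apply le_antisymm
  · refine sSup_le ?_
    rintro _ ⟨h, hqc, hhV, rfl⟩
    refine le_sInf ?_
    rintro _ ⟨φ, ⟨L, hL⟩, hφc, hφU, rfl⟩
    have hF : ∀ U' : Set (Vec d), IsOpen U' → Bornology.IsBounded U' → ∀ A ψ, IsTest U' ψ →
        h (strain A) * volume.real U' ≤ ∫ x in U', h (strain (A + fderiv ℝ ψ x)) := by
      intro U' hU'o hU'b A ψ hψ
      simp only [strain_add]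
      exact hqc U' hU'o hU'b (strain A) ψ hψ.lipschitz hψ.compact hψ.subset
    have hcont : Continuous fun G : Lin d => h (strain G) :=
      continuous_of_quasiconvex hd hb (fun A => hhV _) fun A ψ hψ => by
        rw [mul_comm]
        exact hF _ Metric.isOpen_ball Metric.isBounded_ball A ψ hψ
    have h1 := hF U hUo hUb (symLin E) φ ⟨⟨L, hL⟩, hφc, hφU⟩
    have h2 : ∫ x in U, h (strain (symLin E + fderiv ℝ φ x)) ≤
        ∫ x in U, W (symLin E + fderiv ℝ φ x) :=
      setIntegral_mono
        (integrableOn_comp_fderiv hcont.measurable (Continuous.bddOnBdd hcont) _ hL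
          hUb.measure_lt_top.ne)
        (integrableOn_comp_fderiv hW hb _ hL hUb.measure_lt_top.ne) fun x => hhV _
    rw [strain_symLin] at h1
    rw [hVW, EReal.coe_le_coe_iff, one_div]
    refine (le_inv_mul_iff₀ hv).2 ?_
    rw [mul_comm]
    exact h1.trans h2
  · refine EReal.le_of_forall_lt_iff_le.1 fun c hc => ?_
    have hclose : ∀ ζ : Lin d → ℝ, Measurable ζ → BddOnBdd ζ → HasTests W ζ →
        ζ (symLin E) < c → sInf {y : EReal | ∃ φ : (Fin d → ℝ) → (Fin d → ℝ),
          (∃ L : NNReal, LipschitzWith L φ) ∧ HasCompactSupport φ ∧ tsupport φ ⊆ U ∧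
          y = ((1 / (volume U).toReal *
            ∫ x in U, V ⟨E.1 + symPart (Dmat φ x), E.2.add (symPart_isSymm _)⟩ : ℝ) : EReal)} ≤
          (c : EReal) := by
      intro ζ hζ hζb H hζc
      obtain ⟨φ, hφ, hφi⟩ := exists_average_le hW hb hζ hζb H hUo hUb hUne hζc
      refine sInf_le_of_le ⟨φ, hφ.lipschitz, hφ.compact, hφ.subset, rfl⟩ ?_
      rw [hVW, EReal.coe_le_coe_iff]
      exact hφi
    by_cases hbdd : ∀ A, BddBelow (averages W A)
    · have hcont := continuous_relax hd hW hb hbdd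
      refine hclose (relax W) hcont.measurable (Continuous.bddOnBdd hcont) hasTests_relax ?_
      rw [← EReal.coe_lt_coe_iff]
      refine lt_of_le_of_lt (le_sSup ?_) hc
      refine ⟨fun E' => relax W (symLin E'), ?_, fun E' => ?_, rfl⟩
      · intro U' hU'o hU'b E' ψ hψL hψc hψU
        have h := mul_volume_le_setIntegral hcont
          (fun A ψ hψ => relax_mul_volume_le hd hW hb hbdd A hψ) hU'o hU'b (symLin E')
          ⟨hψL, hψc, hψU⟩
        refine h.trans_eq (integral_congr_ae (Filter.Eventually.of_forall fun x => ?_))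
        refine (relax_symLin_strain V (symLin E' + fderiv ℝ ψ x)).symm.trans ?_
        simp only [strain_add, strain_symLin]
        rfl
      · simpa only [hW_def, strain_symLin] using relax_le hbdd (symLin E')
    · push Not at hbdd
      obtain ⟨A, hA⟩ := hbdd
      have hun : ∀ B, ¬ BddBelow (averages W B) := fun B hB =>
        hA (bddBelow_averages hd hW hb hB A)
      refine hclose (fun _ => c - 1) measurable_const (fun R => ⟨|c - 1|, fun _ _ => le_rfl⟩)
        (fun B ε hε => ?_) (sub_one_lt c)
      obtain ⟨y, hy, hyc⟩ := not_bddBelow_iff.1 (hun B) (c - 1 + ε)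
      exact exists_test_of_mem_averages hy hyc.le
end
end
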